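/- Let n ≥ 4 and m ≥ 1 be integers with m ≤ C(n,2), and set s = ⌈1/(1 − 2m/n²)⌉. Then every simple graph G with n vertices and m edges satisfies k_4(G) ≥ C(s,4) · (1/s⁴) · (n − 3√(n² − 2sm/(s−1))) · (n + √(n² − 2sm/(s−1)))³. -/

import Mathlib

/-- `k_r(G)`: the number of `r`-cliques of a simple graph `G`. -/
noncomputable def kcliques {V : Type*} (G : SimpleGraph V) (r : ℕ) : ℕ :=
  {t : Finset V | G.IsNClique r t}.ncard

/-- `s = ⌈1/(1 - 2m/n²)⌉`. -/
noncomputable def sOf (n m : ℕ) : ℕ := ⌈1 / (1 - 2 * (m : ℝ) / (n : ℝ) ^ 2)⌉₊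

open Finset

/-- The weights that a vertex `i` induces on its neighbourhood. -/
def linkWeight {ι : Type*} (a : ι → ι → ℝ) (w : ι → ℝ) (i : ι) : ι → ℝ := fun j => a i j * w j

/-- The number of ordered `r`-cliques of the graph with edge weights `a` and vertex weights `w`. -/
def cliqueSum {ι : Type*} [Fintype ι] (a : ι → ι → ℝ) : ℕ → (ι → ℝ) → ℝ
  | 0, _ => 1
  | r + 1, w => ∑ i, w i * cliqueSum a r (linkWeight a w i)

/-- Symmetric edge weights in the unit interval. -/
structure IsEdgeWeight {ι : Type*} (a : ι → ι → ℝ) : Prop where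
  symm : ∀ i j, a i j = a j i
  nonneg : ∀ i j, 0 ≤ a i j
  le_one : ∀ i j, a i j ≤ 1

lemma linkWeight_nonneg {ι : Type*} {a : ι → ι → ℝ} {w : ι → ℝ} (ha : IsEdgeWeight a)
    (hw : ∀ i, 0 ≤ w i) (i j : ι) :
    0 ≤ linkWeight a w i j := mul_nonneg (ha.nonneg i j) (hw j)

lemma linkWeight_comm {ι : Type*} (a : ι → ι → ℝ) (w : ι → ℝ) (i j : ι) :
    linkWeight a (linkWeight a w i) j = linkWeight a (linkWeight a w j) i := by
  funext k; simp only [linkWeight]; ring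

section WeightedGraph

variable {ι : Type*} [Fintype ι] {a : ι → ι → ℝ} {w : ι → ℝ}

lemma cliqueSum_succ (a : ι → ι → ℝ) (r : ℕ) (w : ι → ℝ) :
    cliqueSum a (r + 1) w = ∑ i, w i * cliqueSum a r (linkWeight a w i) := rfl

lemma cliqueSum_one (a : ι → ι → ℝ) (w : ι → ℝ) : cliqueSum a 1 w = ∑ i, w i := by
  simp [cliqueSum]

lemma cliqueSum_nonneg (ha : IsEdgeWeight a) (r : ℕ) (hw : ∀ i, 0 ≤ w i) :
    0 ≤ cliqueSum a r w := by
  induction r generalizing w with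
  | zero => simp [cliqueSum]
  | succ r ih =>
    exact sum_nonneg fun i _ => mul_nonneg (hw i) (ih (linkWeight_nonneg ha hw i))

lemma cliqueSum_smul (a : ι → ι → ℝ) (r : ℕ) (c : ℝ) (w : ι → ℝ) :
    cliqueSum a r (fun i => c * w i) = c ^ r * cliqueSum a r w := by
  induction r generalizing w with
  | zero => simp [cliqueSum]
  | succ r ih =>
    have h : ∀ i, linkWeight a (fun i => c * w i) i = fun j => c * linkWeight a w i j :=
      fun i => by funext j; simp only [linkWeight]; ring
    simp only [cliqueSum_succ, h, ih, mul_sum]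
    exact sum_congr rfl fun i _ => by ring

lemma sum_link_cliqueSum (a : ι → ι → ℝ) (r : ℕ) (w : ι → ℝ) (i : ι) :
    ∑ j, w i * w j * a i j * cliqueSum a r (linkWeight a (linkWeight a w i) j) =
      w i * cliqueSum a (r + 1) (linkWeight a w i) := by
  rw [cliqueSum_succ, mul_sum]
  exact sum_congr rfl fun j _ => by simp only [linkWeight]; ring

lemma cliqueSum_add_two (a : ι → ι → ℝ) (r : ℕ) (w : ι → ℝ) :
    cliqueSum a (r + 2) w =
      ∑ i, ∑ j, w i * w j * a i j * cliqueSum a r (linkWeight a (linkWeight a w i) j) := by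
  simp only [sum_link_cliqueSum]
  rfl

/-- First variation of the clique sums along a curve of weights. -/
lemma hasDerivAt_cliqueSum (ha : IsEdgeWeight a) {α : ℝ → ι → ι → ℝ} {α' : ι → ι → ℝ}
    (hα : ∀ i j, HasDerivAt (fun t => α t i j) (α' i j) 0)
    (hα0 : α 0 = a) (r : ℕ) {v : ℝ → ι → ℝ} {v' : ι → ℝ} (hv0 : v 0 = w)
    (hv : ∀ i, HasDerivAt (fun t => v t i) (v' i) 0) :
    HasDerivAt (fun t => cliqueSum (α t) (r + 2) (v t))
      ((r + 2) * ∑ i, v' i * cliqueSum a (r + 1) (linkWeight a w i) +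
        (r + 2) * (r + 1) / 2 * ∑ i, ∑ j, w i * w j * α' i j *
          cliqueSum a r (linkWeight a (linkWeight a w i) j)) 0 := by
  have hlink : ∀ {v : ℝ → ι → ℝ} {v' : ι → ℝ} {w : ι → ℝ}, v 0 = w →
      (∀ i, HasDerivAt (fun t => v t i) (v' i) 0) → ∀ i j,
      HasDerivAt (fun t => linkWeight (α t) (v t) i j) (α' i j * w j + a i j * v' j) 0 := by
    intro v v' w hv0 hv i j
    have := (hα i j).mul (hv j)
    rw [hα0, hv0] at this
    exact this
  induction r generalizing v v' w with
  | zero =>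
    have h : ∀ i, HasDerivAt (fun t => v t i * ∑ j, linkWeight (α t) (v t) i j)
        (v' i * ∑ j, linkWeight a w i j +
          w i * ∑ j, (α' i j * w j + a i j * v' j)) 0 := by
      intro i
      have := (hv i).mul (HasDerivAt.fun_sum (u := univ) fun j _ => hlink hv0 hv i j)
      rw [hα0, hv0] at this
      exact this
    have h2 := HasDerivAt.fun_sum (u := univ) fun i _ => h i
    simp only [cliqueSum, mul_one] at h2 ⊢
    refine h2.congr_deriv ?_
    have e : ∑ i, v' i * ∑ j, linkWeight a w i j = ∑ i, w i * ∑ j, a i j * v' j := by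
      simp only [mul_sum, linkWeight]
      rw [sum_comm]
      exact sum_congr rfl fun i _ => sum_congr rfl fun j _ => by rw [ha.symm]; ring
    simp only [sum_add_distrib, mul_add]
    rw [← e]
    have e2 : ∑ i, ∑ j, w i * w j * α' i j = ∑ i, w i * ∑ j, α' i j * w j := by
      simp only [mul_sum]
      exact sum_congr rfl fun i _ => sum_congr rfl fun j _ => by ring
    rw [e2]
    push_cast
    ring
  | succ r ih =>
    have h : ∀ i, HasDerivAt
        (fun t => v t i * cliqueSum (α t) (r + 2) (linkWeight (α t) (v t) i)) _ 0 := fun i =>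
      (hv i).mul (ih (w := linkWeight a w i) (by rw [hα0, hv0]) (hlink hv0 hv i))
    have h2 := HasDerivAt.fun_sum (u := univ) fun i _ => h i
    refine h2.congr_deriv ?_
    rw [hα0, hv0]
    have e1 : ∑ i, w i * ∑ j, a i j * v' j *
          cliqueSum a (r + 1) (linkWeight a (linkWeight a w i) j) =
        ∑ i, v' i * cliqueSum a (r + 2) (linkWeight a w i) := by
      simp only [mul_sum]
      rw [sum_comm]
      refine sum_congr rfl fun j _ => ?_
      rw [cliqueSum_succ, mul_sum]
      refine sum_congr rfl fun i _ => ?_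
      rw [linkWeight_comm, ha.symm]
      simp only [linkWeight]; ring
    have e2 : ∑ i, w i * ∑ j, α' i j * w j *
          cliqueSum a (r + 1) (linkWeight a (linkWeight a w i) j) =
        ∑ i, ∑ j, w i * w j * α' i j *
          cliqueSum a (r + 1) (linkWeight a (linkWeight a w i) j) := by
      simp only [mul_sum]
      exact sum_congr rfl fun i _ => sum_congr rfl fun j _ => by ring
    have e3 : ∑ i, w i * ∑ j, ∑ k, linkWeight a w i j * linkWeight a w i k * α' j k *
          cliqueSum a r (linkWeight a (linkWeight a (linkWeight a w i) j) k) =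
        ∑ i, ∑ j, w i * w j * α' i j *
          cliqueSum a (r + 1) (linkWeight a (linkWeight a w i) j) := by
      simp only [mul_sum, cliqueSum_succ]
      rw [sum_comm]
      refine sum_congr rfl fun j _ => ?_
      rw [sum_comm]
      refine sum_congr rfl fun k _ => sum_congr rfl fun i _ => ?_
      rw [linkWeight_comm a w i j, linkWeight_comm a (linkWeight a w j) i k]
      have h1 := ha.symm i j
      have h2 := ha.symm i k
      simp only [linkWeight] at *
      rw [h1, h2]; ring
    have e4 : ∀ i, v' i * cliqueSum a (r + 2) (linkWeight a w i) +
        w i * ((r + 2) * ∑ j, (α' i j * w j + a i j * v' j) *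
            cliqueSum a (r + 1) (linkWeight a (linkWeight a w i) j) +
          (r + 2) * (r + 1) / 2 * ∑ j, ∑ k, linkWeight a w i j * linkWeight a w i k * α' j k *
            cliqueSum a r (linkWeight a (linkWeight a (linkWeight a w i) j) k)) =
        v' i * cliqueSum a (r + 2) (linkWeight a w i) +
        (r + 2) * (w i * ∑ j, α' i j * w j *
          cliqueSum a (r + 1) (linkWeight a (linkWeight a w i) j)) +
        (r + 2) * (w i * ∑ j, a i j * v' j *
          cliqueSum a (r + 1) (linkWeight a (linkWeight a w i) j)) +
        (r + 2) * (r + 1) / 2 *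
          (w i * ∑ j, ∑ k, linkWeight a w i j * linkWeight a w i k * α' j k *
            cliqueSum a r (linkWeight a (linkWeight a (linkWeight a w i) j) k)) := by
      intro i
      simp only [add_mul, sum_add_distrib]
      ring
    rw [sum_congr rfl fun i _ => e4 i]
    simp only [sum_add_distrib, ← mul_sum]
    rw [e1, e2, e3]
    push_cast
    ring

end WeightedGraph

section WeightedGraph

variable {ι : Type*} [Fintype ι] {a : ι → ι → ℝ} {w : ι → ℝ}

lemma continuous_cliqueSum (r : ℕ) {X : Type*} [TopologicalSpace X] {α : X → ι → ι → ℝ}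
    {v : X → ι → ℝ} (hα : ∀ i j, Continuous fun x => α x i j)
    (hv : ∀ i, Continuous fun x => v x i) :
    Continuous fun x => cliqueSum (α x) r (v x) := by
  induction r generalizing v with
  | zero => exact continuous_const
  | succ r ih =>
    exact continuous_finsetSum _ fun i _ => (hv i).mul (ih fun j => (hα i j).mul (hv j))


/-- The weight of the vertices not adjacent to `i` nor to `j`. -/
def coLinkSum (a : ι → ι → ℝ) (w : ι → ℝ) (i j : ι) : ℝ :=
  ∑ k, w k * (1 - a i k) * (1 - a j k)

lemma coLinkSum_nonneg (ha : IsEdgeWeight a) (hw : ∀ i, 0 ≤ w i) (i j : ι) :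
    0 ≤ coLinkSum a w i j :=
  sum_nonneg fun k _ => mul_nonneg (mul_nonneg (hw k) (sub_nonneg.2 (ha.le_one i k)))
    (sub_nonneg.2 (ha.le_one j k))

lemma coLinkSum_comm (a : ι → ι → ℝ) (w : ι → ℝ) (i j : ι) :
    coLinkSum a w i j = coLinkSum a w j i :=
  sum_congr rfl fun k _ => by ring

lemma coLinkSum_eq (a : ι → ι → ℝ) (w : ι → ℝ) (i j : ι) :
    coLinkSum a w i j = ∑ k, w k - cliqueSum a 1 (linkWeight a w i) -
      cliqueSum a 1 (linkWeight a w j) + cliqueSum a 1 (linkWeight a (linkWeight a w i) j) := by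
  simp only [coLinkSum, cliqueSum_one, linkWeight, ← sum_sub_distrib, ← sum_add_distrib]
  exact sum_congr rfl fun k _ => by ring

lemma sum_coLinkSum_mul (ha : IsEdgeWeight a) (r : ℕ) :
    ∑ i, ∑ j, w i * w j * a i j * coLinkSum a w i j *
        cliqueSum a r (linkWeight a (linkWeight a w i) j) =
      (∑ i, w i) * cliqueSum a (r + 2) w -
        2 * ∑ i, w i * cliqueSum a 1 (linkWeight a w i) *
          cliqueSum a (r + 1) (linkWeight a w i) +
        ∑ i, ∑ j, w i * w j * a i j * (cliqueSum a 1 (linkWeight a (linkWeight a w i) j) *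
          cliqueSum a r (linkWeight a (linkWeight a w i) j)) := by
  have h1 : ∑ i, ∑ j, w i * w j * a i j * (cliqueSum a 1 (linkWeight a w i) *
      cliqueSum a r (linkWeight a (linkWeight a w i) j)) =
      ∑ i, w i * cliqueSum a 1 (linkWeight a w i) * cliqueSum a (r + 1) (linkWeight a w i) := by
    refine sum_congr rfl fun i _ => ?_
    rw [mul_right_comm, ← sum_link_cliqueSum, sum_mul]
    exact sum_congr rfl fun j _ => by ring
  have h2 : ∑ i, ∑ j, w i * w j * a i j * (cliqueSum a 1 (linkWeight a w j) *
      cliqueSum a r (linkWeight a (linkWeight a w i) j)) =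
      ∑ i, w i * cliqueSum a 1 (linkWeight a w i) * cliqueSum a (r + 1) (linkWeight a w i) := by
    rw [← h1, sum_comm]
    refine sum_congr rfl fun j _ => sum_congr rfl fun i _ => ?_
    rw [ha.symm, linkWeight_comm]; ring
  rw [cliqueSum_add_two, two_mul, ← sub_sub]
  nth_rw 1 [← h1]
  rw [← h2]
  simp only [mul_sum, ← sum_sub_distrib, ← sum_add_distrib]
  refine sum_congr rfl fun i _ => sum_congr rfl fun j _ => ?_
  rw [coLinkSum_eq]
  ring

/-- Goodman's inequality. -/
lemma goodman (ha : IsEdgeWeight a) (hw : ∀ i, 0 ≤ w i) :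
    2 * cliqueSum a 2 w ^ 2 - (∑ i, w i) ^ 2 * cliqueSum a 2 w ≤ (∑ i, w i) * cliqueSum a 3 w := by
  have h := sum_coLinkSum_mul (w := w) ha 0
  have h0 : 0 ≤ ∑ i, ∑ j, w i * w j * a i j * coLinkSum a w i j *
      cliqueSum a 0 (linkWeight a (linkWeight a w i) j) :=
    sum_nonneg fun i _ => sum_nonneg fun j _ => mul_nonneg (mul_nonneg
      (mul_nonneg (mul_nonneg (hw i) (hw j)) (ha.nonneg i j)) (coLinkSum_nonneg ha hw i j))
      zero_le_one
  have h3 : cliqueSum a 3 w = ∑ i, ∑ j, w i * w j * a i j *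
      (cliqueSum a 1 (linkWeight a (linkWeight a w i) j) *
        cliqueSum a 0 (linkWeight a (linkWeight a w i) j)) := by
    rw [cliqueSum_add_two]; simp only [cliqueSum, mul_one]
  have hW : 0 ≤ ∑ i, w i := sum_nonneg fun i _ => hw i
  have hc : cliqueSum a 2 w ^ 2 ≤ (∑ i, w i) * ∑ i, w i * cliqueSum a 1 (linkWeight a w i) *
      cliqueSum a (0 + 1) (linkWeight a w i) := by
    rw [cliqueSum_succ]
    refine sum_sq_le_sum_mul_sum_of_sq_le_mul _ (fun i _ => hw i) (fun i _ => ?_) fun i _ => le_of_eq (by ring)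
    exact mul_nonneg (mul_nonneg (hw i) (cliqueSum_nonneg ha _ (linkWeight_nonneg ha hw i)))
      (cliqueSum_nonneg ha _ (linkWeight_nonneg ha hw i))
  rw [h, ← h3] at h0
  nlinarith [mul_nonneg hW h0]

section Symmetrization

/-- The weight of an ordered triangle. -/
def tripleWeight (a : ι → ι → ℝ) (w : ι → ℝ) (i j k : ι) : ℝ :=
  w i * w j * w k * (a i j * a i k * a j k)

/-- The weight of an ordered `4`-clique. -/
def quadWeight (a : ι → ι → ℝ) (w : ι → ℝ) (i j k l : ι) : ℝ :=
  tripleWeight a w i j k * (w l * (a i l * a j l * a k l))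

lemma sum_tripleWeight_swap_left (ha : IsEdgeWeight a) (F : ι → ι → ι → ℝ) :
    ∑ i, ∑ j, ∑ k, tripleWeight a w i j k * F i j k =
      ∑ i, ∑ j, ∑ k, tripleWeight a w i j k * F j i k := by
  rw [sum_comm]
  refine sum_congr rfl fun i _ => sum_congr rfl fun j _ => sum_congr rfl fun k _ => ?_
  simp only [tripleWeight, ha.symm j i]; ring

lemma sum_tripleWeight_swap_right (ha : IsEdgeWeight a) (F : ι → ι → ι → ℝ) :
    ∑ i, ∑ j, ∑ k, tripleWeight a w i j k * F i j k =
      ∑ i, ∑ j, ∑ k, tripleWeight a w i j k * F i k j := by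
  refine sum_congr rfl fun i _ => ?_
  rw [sum_comm]
  refine sum_congr rfl fun j _ => sum_congr rfl fun k _ => ?_
  simp only [tripleWeight, ha.symm k j]; ring

lemma sum_quadWeight_swap_left (ha : IsEdgeWeight a) (F : ι → ι → ι → ι → ℝ) :
    ∑ i, ∑ j, ∑ k, ∑ l, quadWeight a w i j k l * F i j k l =
      ∑ i, ∑ j, ∑ k, ∑ l, quadWeight a w i j k l * F j i k l := by
  rw [sum_comm]
  refine sum_congr rfl fun i _ => sum_congr rfl fun j _ => sum_congr rfl fun k _ =>
    sum_congr rfl fun l _ => ?_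
  simp only [quadWeight, tripleWeight, ha.symm j i]; ring

lemma sum_quadWeight_swap_middle (ha : IsEdgeWeight a) (F : ι → ι → ι → ι → ℝ) :
    ∑ i, ∑ j, ∑ k, ∑ l, quadWeight a w i j k l * F i j k l =
      ∑ i, ∑ j, ∑ k, ∑ l, quadWeight a w i j k l * F i k j l := by
  refine sum_congr rfl fun i _ => ?_
  rw [sum_comm]
  refine sum_congr rfl fun j _ => sum_congr rfl fun k _ => sum_congr rfl fun l _ => ?_
  simp only [quadWeight, tripleWeight, ha.symm k j]; ring

lemma sum_quadWeight_swap_right (ha : IsEdgeWeight a) (F : ι → ι → ι → ι → ℝ) :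
    ∑ i, ∑ j, ∑ k, ∑ l, quadWeight a w i j k l * F i j k l =
      ∑ i, ∑ j, ∑ k, ∑ l, quadWeight a w i j k l * F i j l k := by
  refine sum_congr rfl fun i _ => sum_congr rfl fun j _ => ?_
  rw [sum_comm]
  refine sum_congr rfl fun k _ => sum_congr rfl fun l _ => ?_
  simp only [quadWeight, tripleWeight, ha.symm l k]; ring

lemma tripleWeight_nonneg {ι : Type*} {a : ι → ι → ℝ} {w : ι → ℝ} (ha : IsEdgeWeight a)
    (hw : ∀ i, 0 ≤ w i) (i j k : ι) :
    0 ≤ tripleWeight a w i j k :=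
  mul_nonneg (mul_nonneg (mul_nonneg (hw i) (hw j)) (hw k))
    (mul_nonneg (mul_nonneg (ha.nonneg i j) (ha.nonneg i k)) (ha.nonneg j k))

lemma quadWeight_nonneg {ι : Type*} {a : ι → ι → ℝ} {w : ι → ℝ} (ha : IsEdgeWeight a)
    (hw : ∀ i, 0 ≤ w i) (i j k l : ι) :
    0 ≤ quadWeight a w i j k l :=
  mul_nonneg (tripleWeight_nonneg ha hw i j k) (mul_nonneg (hw l)
    (mul_nonneg (mul_nonneg (ha.nonneg i l) (ha.nonneg j l)) (ha.nonneg k l)))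

lemma cliqueSum_add_three (a : ι → ι → ℝ) (r : ℕ) (w : ι → ℝ) :
    cliqueSum a (r + 3) w = ∑ i, ∑ j, ∑ k, tripleWeight a w i j k *
      cliqueSum a r (linkWeight a (linkWeight a (linkWeight a w i) j) k) := by
  rw [cliqueSum_add_two]
  refine sum_congr rfl fun i _ => sum_congr rfl fun j _ => ?_
  rw [cliqueSum_succ, mul_sum]
  exact sum_congr rfl fun k _ => by simp only [tripleWeight, linkWeight]; ring

lemma cliqueSum_add_four (a : ι → ι → ℝ) (r : ℕ) (w : ι → ℝ) :
    cliqueSum a (r + 4) w = ∑ i, ∑ j, ∑ k, ∑ l, quadWeight a w i j k l * cliqueSum a r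
      (linkWeight a (linkWeight a (linkWeight a (linkWeight a w i) j) k) l) := by
  rw [cliqueSum_add_three]
  refine sum_congr rfl fun i _ => sum_congr rfl fun j _ => sum_congr rfl fun k _ => ?_
  rw [cliqueSum_succ, mul_sum]
  exact sum_congr rfl fun l _ => by simp only [quadWeight, tripleWeight, linkWeight]; ring

lemma sum_sq_codegree (a : ι → ι → ℝ) (w : ι → ℝ) :
    ∑ i, ∑ j, w i * w j * a i j * (cliqueSum a 1 (linkWeight a (linkWeight a w i) j) *
      cliqueSum a 1 (linkWeight a (linkWeight a w i) j)) =
    ∑ i, ∑ j, ∑ k, tripleWeight a w i j k * ∑ l, w l * (a i l * a j l) := by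
  refine sum_congr rfl fun i _ => sum_congr rfl fun j _ => ?_
  rw [← sum_mul, cliqueSum_one, ← mul_assoc]
  congr 1
  · rw [mul_sum]
    exact sum_congr rfl fun k _ => by simp only [tripleWeight, linkWeight]; ring
  · exact sum_congr rfl fun k _ => by simp only [linkWeight]; ring

lemma sum_codegree_mul (a : ι → ι → ℝ) (w : ι → ℝ) :
    ∑ i, ∑ j, w i * w j * a i j * (cliqueSum a 1 (linkWeight a (linkWeight a w i) j) *
      cliqueSum a 2 (linkWeight a (linkWeight a w i) j)) =
    ∑ i, ∑ j, ∑ k, ∑ l, quadWeight a w i j k l * ∑ m, w m * (a i m * a j m) := by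
  refine sum_congr rfl fun i _ => sum_congr rfl fun j _ => ?_
  simp only [← sum_mul]
  rw [cliqueSum_one, mul_comm (∑ k, _), ← mul_assoc]
  congr 1
  · simp only [cliqueSum, mul_sum]
    exact sum_congr rfl fun k _ => sum_congr rfl fun l _ => by
      simp only [quadWeight, tripleWeight, linkWeight]; ring
  · exact sum_congr rfl fun k _ => by simp only [linkWeight]; ring

lemma sum_degree_mul_two (a : ι → ι → ℝ) (w : ι → ℝ) :
    ∑ i, w i * cliqueSum a 1 (linkWeight a w i) * cliqueSum a 2 (linkWeight a w i) =
    ∑ i, ∑ j, ∑ k, tripleWeight a w i j k * ∑ l, w l * a i l := by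
  refine sum_congr rfl fun i _ => ?_
  simp only [← sum_mul]
  rw [cliqueSum_one, mul_right_comm]
  congr 1
  · simp only [cliqueSum, mul_sum]
    exact sum_congr rfl fun j _ => sum_congr rfl fun k _ => by
      simp only [tripleWeight, linkWeight]; ring
  · exact sum_congr rfl fun k _ => by simp only [linkWeight]; ring

lemma sum_degree_mul_three (a : ι → ι → ℝ) (w : ι → ℝ) :
    ∑ i, w i * cliqueSum a 1 (linkWeight a w i) * cliqueSum a 3 (linkWeight a w i) =
    ∑ i, ∑ j, ∑ k, ∑ l, quadWeight a w i j k l * ∑ m, w m * a i m := by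
  refine sum_congr rfl fun i _ => ?_
  simp only [← sum_mul]
  rw [cliqueSum_one, mul_right_comm]
  congr 1
  · simp only [cliqueSum, mul_sum]
    exact sum_congr rfl fun j _ => sum_congr rfl fun k _ => sum_congr rfl fun l _ => by
      simp only [quadWeight, tripleWeight, linkWeight]; ring
  · exact sum_congr rfl fun k _ => by simp only [linkWeight]; ring

lemma sum_sq_codegree_le (ha : IsEdgeWeight a) (hw : ∀ i, 0 ≤ w i) :
    3 * ∑ i, ∑ j, w i * w j * a i j * (cliqueSum a 1 (linkWeight a (linkWeight a w i) j) *
      cliqueSum a 1 (linkWeight a (linkWeight a w i) j)) ≤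
    (∑ i, w i) * cliqueSum a 3 w + 2 * cliqueSum a 4 w := by
  have e1 := sum_tripleWeight_swap_right (w := w) ha fun i j _ => ∑ l, w l * (a i l * a j l)
  have e2 := sum_tripleWeight_swap_left (w := w) ha fun i _ k => ∑ l, w l * (a i l * a k l)
  have key : 0 ≤ ∑ i, ∑ j, ∑ k, tripleWeight a w i j k *
      (∑ l, w l + 2 * cliqueSum a 1 (linkWeight a (linkWeight a (linkWeight a w i) j) k) -
        ∑ l, w l * (a i l * a j l) - ∑ l, w l * (a i l * a k l) -
        ∑ l, w l * (a j l * a k l)) := by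
    refine sum_nonneg fun i _ => sum_nonneg fun j _ => sum_nonneg fun k _ =>
      mul_nonneg (tripleWeight_nonneg ha hw i j k) ?_
    rw [cliqueSum_one, mul_sum]
    simp only [← sum_sub_distrib, ← sum_add_distrib]
    refine sum_nonneg fun l _ => ?_
    have hx := ha.nonneg i l
    have hy := ha.nonneg j l
    have hz := ha.nonneg k l
    have hx' := sub_nonneg.2 (ha.le_one i l)
    have hy' := sub_nonneg.2 (ha.le_one j l)
    have hz' := sub_nonneg.2 (ha.le_one k l)
    have : 0 ≤ 1 + 2 * (a i l * a j l * a k l) - a i l * a j l - a i l * a k l - a j l * a k l := by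
      nlinarith [mul_nonneg hx (mul_nonneg hy' hz'), mul_nonneg hy (mul_nonneg hx' hz'),
        mul_nonneg hz (mul_nonneg hx' hy'), mul_nonneg hx' (mul_nonneg hy' hz'),
        mul_nonneg hx (mul_nonneg hy hz)]
    have := mul_nonneg (hw l) this
    simp only [linkWeight]
    linarith
  rw [sum_sq_codegree, cliqueSum_add_three a 1, cliqueSum_add_three a 0]
  simp only [mul_sub, mul_add, sum_sub_distrib, sum_add_distrib] at key
  simp only [cliqueSum, mul_one, mul_left_comm _ (2 : ℝ), ← mul_sum, ← sum_mul] at *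
  linarith

lemma le_sum_sq_codegree (ha : IsEdgeWeight a) (hw : ∀ i, 0 ≤ w i) :
    cliqueSum a 4 w + 3 * ∑ i, w i * cliqueSum a 1 (linkWeight a w i) *
      cliqueSum a 2 (linkWeight a w i) - (∑ i, w i) * cliqueSum a 3 w ≤
    3 * ∑ i, ∑ j, w i * w j * a i j * (cliqueSum a 1 (linkWeight a (linkWeight a w i) j) *
      cliqueSum a 1 (linkWeight a (linkWeight a w i) j)) := by
  have e1 := sum_tripleWeight_swap_right (w := w) ha fun i j _ => ∑ l, w l * (a i l * a j l)
  have e2 := sum_tripleWeight_swap_left (w := w) ha fun i _ k => ∑ l, w l * (a i l * a k l)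
  have e3 := sum_tripleWeight_swap_left (w := w) ha fun i _ _ => ∑ l, w l * a i l
  have e4 := sum_tripleWeight_swap_right (w := w) ha fun _ j _ => ∑ l, w l * a j l
  have key : 0 ≤ ∑ i, ∑ j, ∑ k, tripleWeight a w i j k *
      (∑ l, w l - cliqueSum a 1 (linkWeight a (linkWeight a (linkWeight a w i) j) k) +
        ∑ l, w l * (a i l * a j l) + ∑ l, w l * (a i l * a k l) +
        ∑ l, w l * (a j l * a k l) - ∑ l, w l * a i l - ∑ l, w l * a j l -
        ∑ l, w l * a k l) := by
    refine sum_nonneg fun i _ => sum_nonneg fun j _ => sum_nonneg fun k _ =>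
      mul_nonneg (tripleWeight_nonneg ha hw i j k) ?_
    rw [cliqueSum_one]
    simp only [← sum_sub_distrib, ← sum_add_distrib]
    refine sum_nonneg fun l _ => ?_
    have hx' := sub_nonneg.2 (ha.le_one i l)
    have hy' := sub_nonneg.2 (ha.le_one j l)
    have hz' := sub_nonneg.2 (ha.le_one k l)
    have := mul_nonneg (hw l) (mul_nonneg hx' (mul_nonneg hy' hz'))
    simp only [linkWeight]
    linarith
  rw [sum_sq_codegree, sum_degree_mul_two, cliqueSum_add_three a 1, cliqueSum_add_three a 0]
  simp only [mul_sub, mul_add, sum_sub_distrib, sum_add_distrib] at key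
  simp only [cliqueSum, mul_one, ← sum_mul] at *
  linarith

lemma le_sum_codegree_mul (ha : IsEdgeWeight a) (hw : ∀ i, 0 ≤ w i) :
    cliqueSum a 5 w + 8 * ∑ i, w i * cliqueSum a 1 (linkWeight a w i) *
      cliqueSum a 3 (linkWeight a w i) - 3 * (∑ i, w i) * cliqueSum a 4 w ≤
    6 * ∑ i, ∑ j, w i * w j * a i j * (cliqueSum a 1 (linkWeight a (linkWeight a w i) j) *
      cliqueSum a 2 (linkWeight a (linkWeight a w i) j)) := by
  have e1 := sum_quadWeight_swap_middle (w := w) ha fun i j _ _ => ∑ m, w m * (a i m * a j m)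
  have e2 := sum_quadWeight_swap_left (w := w) ha fun i _ k _ => ∑ m, w m * (a i m * a k m)
  have e3 := sum_quadWeight_swap_right (w := w) ha fun i _ k _ => ∑ m, w m * (a i m * a k m)
  have e4 := sum_quadWeight_swap_left (w := w) ha fun i _ _ l => ∑ m, w m * (a i m * a l m)
  have e5 := sum_quadWeight_swap_middle (w := w) ha fun _ j _ l => ∑ m, w m * (a j m * a l m)
  have f1 := sum_quadWeight_swap_left (w := w) ha fun i _ _ _ => ∑ m, w m * a i m
  have f2 := sum_quadWeight_swap_middle (w := w) ha fun _ j _ _ => ∑ m, w m * a j m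
  have f3 := sum_quadWeight_swap_right (w := w) ha fun _ _ k _ => ∑ m, w m * a k m
  have key : 0 ≤ ∑ i, ∑ j, ∑ k, ∑ l, quadWeight a w i j k l *
      (3 * ∑ m, w m - cliqueSum a 1 (linkWeight a (linkWeight a (linkWeight a
        (linkWeight a w i) j) k) l) +
        ∑ m, w m * (a i m * a j m) + ∑ m, w m * (a i m * a k m) +
        ∑ m, w m * (a j m * a k m) + ∑ m, w m * (a i m * a l m) +
        ∑ m, w m * (a j m * a l m) + ∑ m, w m * (a k m * a l m) - 2 * ∑ m, w m * a i m -
        2 * ∑ m, w m * a j m - 2 * ∑ m, w m * a k m - 2 * ∑ m, w m * a l m) := by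
    refine sum_nonneg fun i _ => sum_nonneg fun j _ => sum_nonneg fun k _ =>
      sum_nonneg fun l _ => mul_nonneg (quadWeight_nonneg ha hw i j k l) ?_
    rw [cliqueSum_one]
    simp only [mul_sum, ← sum_sub_distrib, ← sum_add_distrib]
    refine sum_nonneg fun m _ => ?_
    have hx := ha.nonneg i m
    have hx' := sub_nonneg.2 (ha.le_one i m)
    have hy' := sub_nonneg.2 (ha.le_one j m)
    have hz' := sub_nonneg.2 (ha.le_one k m)
    have hv' := sub_nonneg.2 (ha.le_one l m)
    have hv := ha.nonneg l m
    have hy := ha.nonneg j m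
    have : 0 ≤ 3 - a i m * a j m * a k m * a l m + a i m * a j m + a i m * a k m +
        a j m * a k m + a i m * a l m + a j m * a l m + a k m * a l m -
        2 * a i m - 2 * a j m - 2 * a k m - 2 * a l m := by
      nlinarith [mul_nonneg hx' (mul_nonneg hy' hz'), mul_nonneg hx' (mul_nonneg hy' hv'),
        mul_nonneg hx' (mul_nonneg hz' hv'), mul_nonneg hy' (mul_nonneg hz' hv'),
        mul_nonneg (mul_nonneg hx' hy') (mul_nonneg hz' hv'),
        mul_nonneg hx' hy', mul_nonneg hx' hz', mul_nonneg hy' hz', mul_nonneg hx' hv',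
        mul_nonneg hy' hv', mul_nonneg hz' hv',
        mul_nonneg (mul_nonneg hx hy') (mul_nonneg hz' hv')]
    have := mul_nonneg (hw m) this
    simp only [linkWeight]
    linarith
  rw [sum_codegree_mul, sum_degree_mul_three, cliqueSum_add_four a 1, cliqueSum_add_four a 0]
  simp only [mul_sub, mul_add, sum_sub_distrib, sum_add_distrib] at key
  simp only [cliqueSum, mul_one, mul_left_comm _ (2 : ℝ), mul_left_comm _ (3 : ℝ),
    ← mul_sum, ← sum_mul] at *
  linarith

end Symmetrization

/-- The Moon-Moser inequality between edges, triangles and `4`-cliques. -/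
lemma moon_moser (ha : IsEdgeWeight a) (hw : ∀ i, 0 ≤ w i) :
    3 * cliqueSum a 3 w ^ 2 ≤
      cliqueSum a 2 w * ((∑ i, w i) * cliqueSum a 3 w + 2 * cliqueSum a 4 w) := by
  have h := sum_sq_codegree_le ha hw
  have hB : ∀ i j, 0 ≤ w i * w j * a i j := fun i j =>
    mul_nonneg (mul_nonneg (hw i) (hw j)) (ha.nonneg i j)
  have hc := sum_sq_le_sum_mul_sum_of_sq_le_mul (univ ×ˢ univ : Finset (ι × ι))
    (r := fun x => w x.1 * w x.2 * a x.1 x.2 *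
      cliqueSum a 1 (linkWeight a (linkWeight a w x.1) x.2))
    (f := fun x => w x.1 * w x.2 * a x.1 x.2)
    (g := fun x => w x.1 * w x.2 * a x.1 x.2 *
      (cliqueSum a 1 (linkWeight a (linkWeight a w x.1) x.2) *
        cliqueSum a 1 (linkWeight a (linkWeight a w x.1) x.2)))
    (fun x _ => hB _ _) (fun x _ => mul_nonneg (hB _ _) (mul_self_nonneg _))
    fun x _ => le_of_eq (by ring)
  simp only [sum_product] at hc
  rw [← cliqueSum_add_two] at hc
  have h2 : cliqueSum a 2 w = ∑ i, ∑ j, w i * w j * a i j :=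
    (cliqueSum_add_two a 0 w).trans (by simp only [cliqueSum, mul_one])
  rw [← h2] at hc
  nlinarith [mul_le_mul_of_nonneg_left h (cliqueSum_nonneg ha 2 hw)]

end WeightedGraph

section Minimizer

variable {ι : Type*} [Fintype ι]

/-- The weighted graphs of total weight one whose edge density lies in a given interval. -/
def densityRegion (ι : Type*) [Fintype ι] (γ₀ γ₁ : ℝ) : Set ((ι → ι → ℝ) × (ι → ℝ)) :=
  {x | IsEdgeWeight x.1 ∧ (∀ i, 0 ≤ x.2 i) ∧ ∑ i, x.2 i = 1 ∧ cliqueSum x.1 2 x.2 ∈ Set.Icc γ₀ γ₁}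

lemma isCompact_densityRegion (γ₀ γ₁ : ℝ) : IsCompact (densityRegion ι γ₀ γ₁) := by
  have hb : IsCompact (Set.Icc (0 : (ι → ι → ℝ) × (ι → ℝ)) 1) := isCompact_Icc
  have ha : ∀ i j, Continuous fun x : (ι → ι → ℝ) × (ι → ℝ) => x.1 i j := fun i j => by fun_prop
  have hw : ∀ i, Continuous fun x : (ι → ι → ℝ) × (ι → ℝ) => x.2 i := fun i => by fun_prop
  refine hb.of_isClosed_subset ?_ ?_
  · have : densityRegion ι γ₀ γ₁ =
        ((⋂ i, ⋂ j, {x | x.1 i j = x.1 j i}) ∩ (⋂ i, ⋂ j, {x | 0 ≤ x.1 i j}) ∩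
          (⋂ i, ⋂ j, {x | x.1 i j ≤ 1})) ∩ (⋂ i, {x | 0 ≤ x.2 i}) ∩ {x | ∑ i, x.2 i = 1} ∩
          {x | cliqueSum x.1 2 x.2 ∈ Set.Icc γ₀ γ₁} := by
      ext x
      simp only [densityRegion, Set.mem_ofPred_eq, Set.mem_inter_iff, Set.mem_iInter]
      exact ⟨fun ⟨h1, h2, h3, h4⟩ => ⟨⟨⟨⟨⟨h1.symm, h1.nonneg⟩, h1.le_one⟩, h2⟩, h3⟩, h4⟩,
        fun ⟨⟨⟨⟨⟨h1, h1'⟩, h1''⟩, h2⟩, h3⟩, h4⟩ => ⟨⟨h1, h1', h1''⟩, h2, h3, h4⟩⟩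
    rw [this]
    refine IsClosed.inter (IsClosed.inter (IsClosed.inter (IsClosed.inter (IsClosed.inter ?_ ?_)
      ?_) ?_) ?_) ?_
    · exact isClosed_iInter fun i => isClosed_iInter fun j => isClosed_eq (ha i j) (ha j i)
    · exact isClosed_iInter fun i => isClosed_iInter fun j => isClosed_le continuous_const (ha i j)
    · exact isClosed_iInter fun i => isClosed_iInter fun j => isClosed_le (ha i j) continuous_const
    · exact isClosed_iInter fun i => isClosed_le continuous_const (hw i)
    · exact isClosed_eq (continuous_finsetSum _ fun i _ => hw i) continuous_const
    · exact isClosed_Icc.preimage (continuous_cliqueSum 2 ha hw)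
  · rintro ⟨a, w⟩ ⟨h1, h2, h3, -⟩
    exact ⟨⟨fun i j => h1.nonneg i j, h2⟩, fun i j => h1.le_one i j,
      fun i => (single_le_sum (fun j _ => h2 j) (mem_univ i)).trans_eq h3⟩

/-- If `S_{q+2} < F (S_2)` for some weighted graph with total weight one, then there is a
minimizer of `S_{q+2} - F (S_2)`, and it satisfies the first order conditions for the vertex weights
and the edge weights. -/
lemma exists_critical (q : ℕ) {F : ℝ → ℝ} {F' : ℝ → ℝ} {γ₀ γ₁ : ℝ}
    (hF : ContinuousOn F (Set.Icc γ₀ γ₁)) (hF' : ∀ γ ∈ Set.Ioo γ₀ γ₁, HasDerivAt F (F' γ) γ)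
    (hend : ∀ x ∈ densityRegion ι γ₀ γ₁, cliqueSum x.1 2 x.2 = γ₀ ∨ cliqueSum x.1 2 x.2 = γ₁ →
      F (cliqueSum x.1 2 x.2) ≤ cliqueSum x.1 (q + 2) x.2)
    {x₀ : (ι → ι → ℝ) × (ι → ℝ)} (hx₀ : x₀ ∈ densityRegion ι γ₀ γ₁)
    (hlt : cliqueSum x₀.1 (q + 2) x₀.2 < F (cliqueSum x₀.1 2 x₀.2)) :
    ∃ a w, IsEdgeWeight a ∧ (∀ i : ι, 0 ≤ w i) ∧ ∑ i, w i = 1 ∧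
      cliqueSum a 2 w ∈ Set.Ioo γ₀ γ₁ ∧ cliqueSum a (q + 2) w < F (cliqueSum a 2 w) ∧
      (∀ i, w i = 0 ∨ (q + 2) * (cliqueSum a (q + 1) (linkWeight a w i) - cliqueSum a (q + 2) w) =
        F' (cliqueSum a 2 w) * (2 * (cliqueSum a 1 (linkWeight a w i) - cliqueSum a 2 w))) ∧
      ∀ g : ι → ι → ℝ, (∀ i j, g i j = g j i) → (∀ i j, 0 ≤ g i j) →
        (q + 2) * (q + 1) / 2 * ∑ i, ∑ j, w i * w j * a i j * g i j *
            cliqueSum a q (linkWeight a (linkWeight a w i) j) ≤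
          F' (cliqueSum a 2 w) * ∑ i, ∑ j, w i * w j * a i j * g i j := by
  classical
  have ha : ∀ i j, Continuous fun x : (ι → ι → ℝ) × (ι → ℝ) => x.1 i j := fun i j => by fun_prop
  have hw : ∀ i, Continuous fun x : (ι → ι → ℝ) × (ι → ℝ) => x.2 i := fun i => by fun_prop
  obtain ⟨⟨a, w⟩, hx, hmin⟩ := (isCompact_densityRegion (ι := ι) γ₀ γ₁).exists_isMinOn
    (f := fun x => cliqueSum x.1 (q + 2) x.2 - F (cliqueSum x.1 2 x.2)) ⟨x₀, hx₀⟩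
    ((continuous_cliqueSum (q + 2) ha hw).continuousOn.sub
      (hF.comp (continuous_cliqueSum 2 ha hw).continuousOn fun x hx => hx.2.2.2))
  have hneg : cliqueSum a (q + 2) w < F (cliqueSum a 2 w) := by
    have := hmin hx₀
    simp only [Set.mem_ofPred_eq] at this
    linarith
  have hI : cliqueSum a 2 w ∈ Set.Ioo γ₀ γ₁ := by
    have h1 := hx.2.2.2
    refine ⟨lt_of_le_of_ne h1.1 fun h => ?_, lt_of_le_of_ne h1.2 fun h => ?_⟩
    · exact absurd (hend _ hx (Or.inl h.symm)) (not_le.2 hneg)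
    · exact absurd (hend _ hx (Or.inr h)) (not_le.2 hneg)
  obtain ⟨haw, hw0, hw1, -⟩ := hx
  dsimp only at haw hw0 hw1
  have crit : ∀ {α : ℝ → ι → ι → ℝ} {v : ℝ → ι → ℝ} {D₂ D : ℝ} {l : Filter ℝ}, α 0 = a → v 0 = w →
      HasDerivAt (fun t => cliqueSum (α t) 2 (v t)) D₂ 0 →
      HasDerivAt (fun t => cliqueSum (α t) (q + 2) (v t)) D 0 → l ≤ nhds 0 →
      (∀ᶠ t in l, IsEdgeWeight (α t) ∧ (∀ i, 0 ≤ v t i) ∧ ∑ i, v t i = 1) →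
      HasDerivAt (fun t => cliqueSum (α t) (q + 2) (v t) - F (cliqueSum (α t) 2 (v t)))
        (D - F' (cliqueSum a 2 w) * D₂) 0 ∧
      ∀ᶠ t in l, cliqueSum (α 0) (q + 2) (v 0) - F (cliqueSum (α 0) 2 (v 0)) ≤
        cliqueSum (α t) (q + 2) (v t) - F (cliqueSum (α t) 2 (v t)) := by
    intro α v D₂ D l hα hv h₂ h hl hval
    refine ⟨h.sub (HasDerivAt.comp (0 : ℝ) (h₂ := F) ?_ h₂), ?_⟩
    · rw [hα, hv]; exact hF' _ hI
    · have hc := h₂.continuousAt.eventually_mem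
        (show Set.Ioo γ₀ γ₁ ∈ nhds (cliqueSum (α 0) 2 (v 0)) by
          rw [hα, hv]; exact Ioo_mem_nhds hI.1 hI.2)
      filter_upwards [hl hc, hval] with t h1 h2
      have := hmin (show (α t, v t) ∈ densityRegion ι γ₀ γ₁ from
        ⟨h2.1, h2.2.1, h2.2.2, Set.Ioo_subset_Icc_self h1⟩)
      simpa [hα, hv] using this
  refine ⟨a, w, haw, hw0, hw1, hI, hneg, fun x => ?_, fun g hg hg0 => ?_⟩
  · have hle : w x ≤ 1 := hw1 ▸ single_le_sum (f := w) (fun j _ => hw0 j) (mem_univ x)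
    set v' : ι → ℝ := fun i => w i * ((if i = x then 1 else 0) - w x) with hv'
    have hv : ∀ i, HasDerivAt (fun t : ℝ => w i + t * v' i) (v' i) 0 := fun i => by
      simpa using ((hasDerivAt_id (0 : ℝ)).mul_const (v' i)).const_add (w i)
    have hα : ∀ i j, HasDerivAt (fun _ : ℝ => a i j) ((fun _ _ => 0 : ι → ι → ℝ) i j) 0 :=
      fun i j => hasDerivAt_const _ _
    have d2 := hasDerivAt_cliqueSum haw hα rfl 0 (v := fun t i => w i + t * v' i) (w := w)
      (by simp) hv
    have dr := hasDerivAt_cliqueSum haw hα rfl q (v := fun t i => w i + t * v' i) (w := w)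
      (by simp) hv
    have hsum : ∀ X : ι → ℝ, ∑ i, v' i * X i = w x * (X x - ∑ i, w i * X i) := by
      intro X
      simp only [hv', mul_sub, sub_mul, sum_sub_distrib, mul_ite, ite_mul, mul_one, mul_zero,
        zero_mul, sum_ite_eq', mem_univ, if_true, mul_sum]
      congr 1
      exact sum_congr rfl fun i _ => by ring
    rw [hsum, ← cliqueSum_succ] at d2 dr
    have hval : ∀ᶠ t : ℝ in nhds 0, IsEdgeWeight a ∧ (∀ i, 0 ≤ w i + t * v' i) ∧
        ∑ i, (w i + t * v' i) = 1 := by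
      filter_upwards [Ioo_mem_nhds (show (-1 : ℝ) < 0 by norm_num) one_pos] with t ht
      refine ⟨haw, fun i => ?_, ?_⟩
      · have : 0 ≤ 1 + t * ((if i = x then 1 else 0) - w x) := by
          have h0 := hw0 x
          have := ht.1
          have := ht.2
          split_ifs <;> nlinarith
        have := mul_nonneg (hw0 i) this
        simp only [hv']
        linarith
      · have := hsum fun _ => 1
        simp only [mul_one, hw1, sub_self, mul_zero] at this
        rw [sum_add_distrib, ← mul_sum, this, hw1, mul_zero, add_zero]
    obtain ⟨hd, hm⟩ := crit rfl (by simp) d2 dr le_rfl hval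
    have h0 := IsLocalMin.hasDerivAt_eq_zero (by exact hm) hd
    rw [or_iff_not_imp_left]
    intro hwx
    apply mul_left_cancel₀ hwx
    simp only [mul_zero, sum_const_zero, zero_mul, Nat.cast_zero, zero_add] at h0
    linarith
  · have hv : ∀ i, HasDerivAt (fun _ : ℝ => w i) ((fun _ => 0 : ι → ℝ) i) 0 :=
      fun i => hasDerivAt_const _ _
    have hα : ∀ i j, HasDerivAt (fun t : ℝ => a i j * (1 - t * g i j))
        ((fun i j => -(a i j * g i j) : ι → ι → ℝ) i j) 0 := fun i j => by
      simpa using (((hasDerivAt_id (0 : ℝ)).mul_const (g i j)).const_sub 1).const_mul (a i j)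
    have d2 := hasDerivAt_cliqueSum haw (α := fun t i j => a i j * (1 - t * g i j)) hα
      (by simp) 0 (v := fun _ => w) rfl hv
    have dr := hasDerivAt_cliqueSum haw (α := fun t i j => a i j * (1 - t * g i j)) hα
      (by simp) q (v := fun _ => w) rfl hv
    have hval : ∀ᶠ t : ℝ in nhdsWithin 0 (Set.Ioi 0),
        IsEdgeWeight (fun i j => a i j * (1 - t * g i j)) ∧ (∀ i, 0 ≤ w i) ∧ ∑ i, w i = 1 := by
      have : ∀ᶠ t : ℝ in nhds 0, ∀ i j, t * g i j < 1 := by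
        refine Filter.eventually_all.2 fun i => Filter.eventually_all.2 fun j => ?_
        have hc : Continuous fun t : ℝ => t * g i j := by fun_prop
        exact hc.continuousAt.eventually_lt continuousAt_const (by simp)
      filter_upwards [this.filter_mono nhdsWithin_le_nhds, self_mem_nhdsWithin] with t ht ht0
      have ht0' : (0 : ℝ) < t := ht0
      refine ⟨⟨fun i j => ?_, fun i j => ?_, fun i j => ?_⟩, hw0, hw1⟩
      · rw [haw.symm, hg]
      · exact mul_nonneg (haw.nonneg i j) (by linarith [ht i j])
      · exact mul_le_one₀ (haw.le_one i j) (by linarith [ht i j])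
          (by linarith [mul_nonneg ht0'.le (hg0 i j)])
    obtain ⟨hd, hm⟩ := crit (by simp) rfl d2 dr nhdsWithin_le_nhds hval
    have h0 := ge_of_tendsto (b := 0) hd.tendsto_slope_zero_right <| by
      filter_upwards [hm, self_mem_nhdsWithin] with t ht ht0
      have ht0' : (0 : ℝ) < t := ht0
      rw [zero_add]
      exact smul_nonneg (inv_pos.2 ht0').le (sub_nonneg.2 ht)
    simp only [zero_mul, sum_const_zero, mul_zero, Nat.cast_zero, zero_add, mul_neg, neg_mul,
      sum_neg_distrib, cliqueSum, mul_one, ← mul_assoc] at h0 ⊢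
    linarith

end Minimizer

section ElementarySymmetric

lemma exists_sizes {p d s : ℝ} (hp : 1 ≤ p) (hd : 0 ≤ d) (h1 : (p - 1) * d ^ 2 ≤ p * s)
    (h2 : (p + 1) * s ≤ p * d ^ 2) :
    ∃ b y, 0 ≤ y ∧ y ≤ b ∧ p * b + y = d ∧ s = p * (p - 1) * b ^ 2 + 2 * p * b * y := by
  set R := Real.sqrt (d ^ 2 - (p + 1) / p * s) with hR
  have hp0 : 0 < p := by linarith
  have hR2 : R ^ 2 = d ^ 2 - (p + 1) / p * s := by
    refine Real.sq_sqrt ?_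
    rw [sub_nonneg, div_mul_eq_mul_div, div_le_iff₀ hp0]; linarith
  have hR2' : p * R ^ 2 = p * d ^ 2 - (p + 1) * s := by rw [hR2]; field_simp
  have hR0 : 0 ≤ R := Real.sqrt_nonneg _
  have hpR : p * R ≤ d := by
    refine abs_le_of_sq_le_sq' ?_ hd |>.2
    nlinarith
  refine ⟨(d + R) / (p + 1), (d - p * R) / (p + 1), ?_, ?_, ?_, ?_⟩
  · exact div_nonneg (by linarith) (by linarith)
  · gcongr; nlinarith
  · field_simp; ring
  · have : s = (p * d ^ 2 - p * R ^ 2) / (p + 1) := by field_simp; linarith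
    rw [this]; field_simp; ring

lemma link_discriminant_nonneg {p d δ : ℝ} (hp : 3 ≤ p) (h1 : p - 1 ≤ d) (hu : d - p ≤ 1 / 4)
    (hdp : 2 * (p - 1) * (d - p) ≤ 1)
    (hδ' : (d - p + 1) * (p * (p - 1) - (p - 2) * d) ≤ (p - 1) * δ) :
    0 ≤ (p - 1) * (p - d) ^ 2 * (p - 1 - d) + δ / 2 * (2 * p - d) * (2 * p - 2 - d) + δ ^ 2 := by
  have hB : 0 ≤ (p * (p - 1) - (p - 2) * d) * ((2 * p - d) * (2 * p - 2 - d)) -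
      2 * (p - 1) ^ 2 * (p - d) ^ 2 := by
    obtain ⟨v, rfl⟩ : ∃ v, d = p - v := ⟨p - d, by ring⟩
    rcases le_total 0 v with hv | hv
    · have a1 : 2 * (p - 1) * v ≤ p * (p - 1) - (p - 2) * (p - v) := by nlinarith
      have a2 : (p - 1) * v ≤ (2 * p - (p - v)) * (2 * p - 2 - (p - v)) := by nlinarith
      have := mul_le_mul a1 a2 (by nlinarith) (by nlinarith)
      linarith
    · have a1 : 2 ≤ p * (p - 1) - (p - 2) * (p - v) := by nlinarith
      have a2 : 1 ≤ (2 * p - (p - v)) * (2 * p - 2 - (p - v)) := by nlinarith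
      have a3 : ((p - 1) * v) ^ 2 ≤ 1 := by
        rw [sq_le_one_iff_abs_le_one, abs_le]; constructor <;> nlinarith
      have := mul_le_mul a1 a2 (by nlinarith) (by nlinarith)
      linarith
  have hC : 0 ≤ (2 * p - d) * (2 * p - 2 - d) := by nlinarith
  refine nonneg_of_mul_nonneg_right (a := 2 * (p - 1)) ?_ (by linarith)
  have b1 := mul_le_mul_of_nonneg_right hδ' hC
  have b2 := mul_nonneg (sub_nonneg.2 h1) hB
  have b3 := mul_nonneg (show 0 ≤ 2 * (p - 1) by linarith) (sq_nonneg δ)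
  linarith

lemma link_bound_three {p d δ s₂ s₃ : ℝ} (hp : 3 ≤ p) (hd : 0 ≤ d) (hδ : 0 ≤ δ)
    (hs₂ : s₂ = 2 * (p - 1) * d - p * (p - 1) - δ) (hs₂0 : 0 ≤ s₂)
    (hgood : 2 * s₂ ^ 2 - d ^ 2 * s₂ ≤ d * s₃) (hdp : 2 * (p - 1) * (d - p) ≤ 1)
    (hind : ∀ b y, 0 ≤ y → y ≤ b → (p - 1) * b + y = d →
      s₂ = (p - 1) * (p - 1 - 1) * b ^ 2 + 2 * (p - 1) * b * y →
      (p - 1) * (p - 1 - 1) * (p - 1 - 2) * b ^ 3 + 3 * (p - 1) * (p - 1 - 1) * b ^ 2 * y ≤ s₃)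
    (hdδ : (p - 1) * (d - p) ≤ δ) :
    3 * (p - 1) * (p - 2) * d - 2 * p * (p - 1) * (p - 2) - (4 * p - 6) * δ ≤ s₃ := by
  have hd0 : 0 < d := by
    rcases hd.eq_or_lt with h | h
    · subst h; nlinarith
    · exact h
  by_cases hE : 0 ≤ (p - 1) * (p - d) ^ 2 * (p - 1 - d) + δ / 2 * (2 * p - d) * (2 * p - 2 - d) + δ ^ 2
  · refine le_of_mul_le_mul_left ?_ hd0
    subst hs₂
    nlinarith
  have h1 : p - 1 < d := by
    by_contra! h
    refine hE (add_nonneg (add_nonneg (mul_nonneg (mul_nonneg (by linarith)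
      (sq_nonneg _)) (by linarith)) ?_) (sq_nonneg _))
    exact mul_nonneg (mul_nonneg (by linarith) (by linarith)) (by linarith)
  have hu : d - p ≤ 1 / 4 := by nlinarith
  have h2 : (p - 2) * d ^ 2 ≤ (p - 1) * s₂ := by
    by_contra! h
    refine hE ?_
    have hδ' : (d - p + 1) * (p * (p - 1) - (p - 2) * d) ≤ (p - 1) * δ := by
      subst hs₂; nlinarith
    exact link_discriminant_nonneg hp h1.le (by linarith) hdp hδ'
  obtain ⟨b, y, hy0, hyb, hsum, hs⟩ := exists_sizes (p := p - 1) (d := d) (s := s₂) (by linarith) hd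
    (by linarith) (by
      subst hs₂
      nlinarith [sq_nonneg (d - p)])
  have h3 := hind b y hy0 hyb hsum hs
  have hb : 0 ≤ b := by linarith
  have hb2 : (p - 2) * b ^ 2 ≤ 2 * p - 2 := by
    have c1 : (p - 1) * (b - 1) ≤ 5 / 4 := by linarith
    rcases le_total b 1 with h | h
    · have := mul_le_mul_of_nonneg_left (pow_le_one₀ hb h : b ^ 2 ≤ 1) (by linarith : 0 ≤ p - 2)
      linarith
    · have := mul_le_mul_of_nonneg_right (show (p - 2) * (b - 1) ≤ 5 / 4 - (b - 1) by linarith)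
        (show 0 ≤ b + 1 by linarith)
      linarith [mul_nonneg (sub_nonneg.2 h) (show 0 ≤ b - 1 / 4 by linarith)]
  have hid : (p - 1) * (p - 1 - 1) * (p - 1 - 2) * b ^ 3 + 3 * (p - 1) * (p - 1 - 1) * b ^ 2 * y -
      3 * (p - 1) * (p - 2) * d + 2 * p * (p - 1) * (p - 2) + (p - 2) * (b ^ 2 + 2) * δ =
      (p - 2) * (b - 1) ^ 2 * (δ - (p - 1) * (d - p)) := by
    have hδe : δ = 2 * (p - 1) * d - p * (p - 1) -
        ((p - 1) * (p - 1 - 1) * b ^ 2 + 2 * (p - 1) * b * y) := by linarith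
    rw [hδe, ← hsum]; ring
  have e1 : 0 ≤ (p - 2) * (b - 1) ^ 2 * (δ - (p - 1) * (d - p)) :=
    mul_nonneg (mul_nonneg (by linarith) (sq_nonneg _)) (by linarith)
  have e2 := mul_nonneg (sub_nonneg.2 hb2) hδ
  linarith

end ElementarySymmetric

section ElementarySymmetric

lemma four_cliques_of_goodman_of_moon_moser {d b s₂ s₃ s₄ : ℝ} (hd : 0 < d) (hb : 2 * b ≤ d)
    (hs₂ : s₂ = d * (d - b)) (hs₄ : 0 ≤ s₄) (hgood : 2 * s₂ ^ 2 - d ^ 2 * s₂ ≤ d * s₃)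
    (hmm : 3 * s₃ ^ 2 ≤ s₂ * (d * s₃ + 2 * s₄)) :
    d * (d - b) * (d - 2 * b) ≤ s₃ ∧ d * (d - b) * (d - 2 * b) * (d - 3 * b) ≤ s₄ := by
  have hdb : 0 < d - b := by linarith
  have hs₂0 : 0 < s₂ := hs₂ ▸ mul_pos hd hdb
  have h3 : d * (d - b) * (d - 2 * b) ≤ s₃ := by
    refine le_of_mul_le_mul_left ?_ hd
    rw [hs₂] at hgood
    linarith
  refine ⟨h3, ?_⟩
  have hE3 : 0 ≤ d * (d - b) * (d - 2 * b) := mul_nonneg (mul_pos hd hdb).le (by linarith)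
  rcases le_total (d - 3 * b) 0 with h | h
  · exact (mul_nonpos_of_nonneg_of_nonpos hE3 h).trans hs₄
  · refine le_of_mul_le_mul_left ?_ (show 0 < 2 * s₂ by linarith)
    have h4 : 2 * d * (d - b) * (d - 3 * b) ≤ 3 * s₃ - d * s₂ := by rw [hs₂]; linarith
    have := mul_le_mul h3 h4 (mul_nonneg (by positivity) h) (hE3.trans h3)
    have e : 2 * s₂ * (d * (d - b) * (d - 2 * b) * (d - 3 * b)) =
      d * (d - b) * (d - 2 * b) * (2 * d * (d - b) * (d - 3 * b)) := by rw [hs₂]; ring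
    rw [e]
    linarith

lemma density_bound_low_degree {p d b : ℝ} (hp : 3 ≤ p) (hb : 2 * b ≤ d) (hdp : d ≤ p - 1)
    (hd : 2 * p ≤ 3 * d)
    (hD : d * (d - b) * (d - 2 * b) ≤ 3 * ((p - 1) * (p - 2)) * d - 2 * p * ((p - 1) * (p - 2))) :
    3 * ((p - 1) * (p - 2)) * d - 2 * p * ((p - 1) * (p - 2)) - d * (d - b) * (d - 2 * b) ≤
      d * (d - b) * (d - 2 * b) * (d - 3 * b) - 6 * ((p - 1) * (p - 2)) * (d * (d - b)) +
        8 * p * ((p - 1) * (p - 2)) * d - 3 * (p + 1) * p * ((p - 1) * (p - 2)) := by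
  obtain ⟨u, rfl⟩ : ∃ u, b = u + 1 := ⟨b - 1, by ring⟩
  obtain ⟨s, rfl⟩ : ∃ s, p = d + s + 1 := ⟨p - d - 1, by ring⟩
  have hs : 0 ≤ s := by linarith
  have hd2 : 2 ≤ d := by linarith
  have hD' : s * (1 + s) * (3 * d + 2 * s - 2) ≤ d * u * (3 * d - 4 - 2 * u) := by linarith
  have hv : 0 < 3 * d - 4 - 2 * u := by linarith
  have hdu : 0 ≤ d * u := by
    by_contra! h
    have := mul_neg_of_neg_of_pos h hv
    have : 0 ≤ s * (1 + s) * (3 * d + 2 * s - 2) :=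
      mul_nonneg (mul_nonneg hs (by linarith)) (by linarith)
    linarith
  have hu : 0 ≤ u := nonneg_of_mul_nonneg_right hdu (by linarith)
  have h6 : 0 ≤ u * (11 * d - 10 - 6 * u) := mul_nonneg hu (by linarith)
  have key : 0 ≤ s * (1 + s) * (1 - s) * (4 * d + 3 * s - 2) + d * u * (4 * d + 4 * s - 2 +
      s * (12 * d + 6 * s - 10) + u * (11 * d - 10 - 6 * u)) := by
    rcases le_total s 1 with h | h
    · have e1 : 0 ≤ s * (1 + s) * (1 - s) * (4 * d + 3 * s - 2) :=
        mul_nonneg (mul_nonneg (mul_nonneg hs (by linarith)) (by linarith)) (by linarith)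
      have e2 : 0 ≤ s * (12 * d + 6 * s - 10) := mul_nonneg hs (by linarith)
      exact add_nonneg e1 (mul_nonneg hdu (by linarith))
    · have e1 : s * (1 + s) ≤ d * u := by
        refine le_of_mul_le_mul_right (le_trans ?_ hD') hv
        exact mul_le_mul_of_nonneg_left (by linarith) (mul_nonneg hs (by linarith))
      have e2 : (s - 1) * (4 * d + 3 * s - 2) ≤ s * (12 * d + 6 * s - 10) :=
        mul_le_mul (by linarith) (by linarith) (by linarith) hs
      have e3 : 0 ≤ (s - 1) * (4 * d + 3 * s - 2) := mul_nonneg (by linarith) (by linarith)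
      have e4 := mul_le_mul e1 e2 e3 hdu
      have e5 := mul_nonneg hdu h6
      have e6 := mul_nonneg hdu (show 0 ≤ 4 * d + 4 * s - 2 by linarith)
      linarith
  have hfin : d * (d - (u + 1)) * (d - 2 * (u + 1)) ≤ 3 * ((d + s + 1 - 1) * (d + s + 1 - 2)) * d -
    2 * (d + s + 1) * ((d + s + 1 - 1) * (d + s + 1 - 2)) := hD
  linarith

lemma density_bound_high_degree {p d b : ℝ} (hp : 3 ≤ p) (hb : 2 * b ≤ d) (hdp : p - 1 ≤ d)
    (hd : 2 * p * (d - p) ≤ 1) (hbd : d ≤ (p - 1) * b) :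
    3 * ((p - 1) * (p - 2)) * d - 2 * p * ((p - 1) * (p - 2)) - d * (d - b) * (d - 2 * b) ≤
      d * (d - b) * (d - 2 * b) * (d - 3 * b) - 6 * ((p - 1) * (p - 2)) * (d * (d - b)) +
        8 * p * ((p - 1) * (p - 2)) * d - 3 * (p + 1) * p * ((p - 1) * (p - 2)) := by
  obtain ⟨q, rfl⟩ : ∃ q, p = q + 1 := ⟨p - 1, by ring⟩
  have hq0 : q ≠ 0 := by linarith
  obtain ⟨c, rfl⟩ : ∃ c, d = q * c := ⟨d / q, by field_simp⟩
  obtain ⟨v, rfl⟩ : ∃ v, c = v + 1 := ⟨c - 1, by ring⟩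
  have hq : 2 ≤ q := by linarith
  have hqv : 0 ≤ q * v := by linarith
  have hv : 0 ≤ v := nonneg_of_mul_nonneg_right hqv (by linarith)
  have hcb : v + 1 ≤ b := by
    refine le_of_mul_le_mul_left (a := q) ?_ (by linarith)
    linarith
  have hx : 2 * (q + 1) * (q * v - 1) ≤ 1 := by linarith
  have hz : q * v ≤ 7 / 6 := by nlinarith
  have hvz : 2 * v ≤ q * v := mul_le_mul_of_nonneg_right hq hv
  have h1 : 0 ≤ 6 * (q * (q - 1)) - 6 * (q * (v + 1)) ^ 2 + 22 * (v + 1) * (q * (v + 1)) -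
      18 * (v + 1) ^ 2 - 3 * (q * (v + 1)) + 4 * (v + 1) := by
    have e : 6 * (q * (q - 1)) - 6 * (q * (v + 1)) ^ 2 + 22 * (v + 1) * (q * (v + 1)) -
        18 * (v + 1) ^ 2 - 3 * (q * (v + 1)) + 4 * (v + 1) = 13 * q - 14 - 12 * (q * (q * v)) +
          41 * (q * v) - 32 * v - 6 * (q * v) ^ 2 + 22 * (q * v) * v - 18 * v ^ 2 := by ring
    rw [e]
    have f1 := mul_nonneg hqv (sub_nonneg.2 hz)
    have f2 := mul_nonneg hv (sub_nonneg.2 hvz)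
    have f3 := mul_nonneg hqv (sub_nonneg.2 hvz)
    rcases le_total (q * v) 1 with h | h
    · linarith [mul_nonneg (show 0 ≤ q - 2 by linarith) (sub_nonneg.2 h), mul_nonneg hqv hv]
    · linarith [mul_nonneg hv (sub_nonneg.2 h), mul_nonneg hqv hv]
  have h2 : 0 ≤ (q - 2) * (q - 3) * ((v + 1) ^ 3 + (v + 1) ^ 2) +
      (11 * (q + 1) - 5 * (q + 1) ^ 2) * (v + 1) + 3 * (q + 1) * (q + 2) -
      (2 * (q + 1) - (q - 2) * ((v + 1) ^ 2 + (v + 1))) := by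
    have e : (q - 2) * (q - 3) * ((v + 1) ^ 3 + (v + 1) ^ 2) +
        (11 * (q + 1) - 5 * (q + 1) ^ 2) * (v + 1) + 3 * (q + 1) * (q + 2) -
        (2 * (q + 1) - (q - 2) * ((v + 1) ^ 2 + (v + 1))) =
        18 - 21 * (q * v) + 30 * v + 4 * (q * v) ^ 2 - 19 * (q * v) * v + 22 * v ^ 2 +
          v ^ 3 * ((q - 2) * (q - 3)) := by ring
    rw [e]
    have f1 : -(1 / 4) ≤ (q - 2) * (q - 3) := by linarith [sq_nonneg (q - 5 / 2)]
    have f2 := mul_le_mul_of_nonneg_left f1 (pow_nonneg hv 3)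
    have f3 : 0 ≤ v * (1 - v ^ 2) := mul_nonneg hv (by nlinarith)
    have f4 := mul_nonneg hv (sub_nonneg.2 hz)
    have f5 := sq_nonneg v
    rcases le_total (q * v) 1 with h | h
    · linarith [mul_nonneg (sub_nonneg.2 h) (show 0 ≤ 17 - 4 * (q * v) by linarith)]
    · have f6 : 13 * (q * v - 1) ≤ 1 + 6 * v := by
        refine le_of_mul_le_mul_left ?_ (show 0 < q + 1 by linarith)
        linarith
      linarith [sq_nonneg (q * v - 1)]
  have h3 := mul_nonneg (mul_nonneg (mul_nonneg (show 0 ≤ q by linarith) (show 0 ≤ q - 1 by linarith))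
    hv) h2
  have h4 : 0 ≤ (b - (v + 1)) * (11 * (q * (v + 1)) + 2 - 6 * (b + 2 * (v + 1))) :=
    mul_nonneg (by linarith) (by linarith)
  have h5 := mul_nonneg (mul_nonneg (show 0 ≤ q * (v + 1) by linarith)
    (show 0 ≤ b - (v + 1) by linarith)) (add_nonneg h1 h4)
  linarith

lemma balanced_coefficient_bound {p d b y : ℝ} (hp : 3 ≤ p) (hdp : p - 1 ≤ d)
    (hd : 2 * p * (d - p) ≤ 1) (hy0 : 0 ≤ y) (hyb : y ≤ b) (hsum : (p - 1) * b + y = d) :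
    0 ≤ (b - 1) ^ 2 * ((p - 3) * (b ^ 2 + 4 * b) + 7 * p - 9) ∧
    (b - 1) ^ 2 * ((p - 3) * (b ^ 2 + 4 * b) + 7 * p - 9) + 2 * (2 * b + 1) ≤
      2 * (5 * p - 3 - (p - 3) * (3 * b ^ 2 + 2 * b)) := by
  have hb0 : 0 ≤ b := hy0.trans hyb
  refine ⟨mul_nonneg (sq_nonneg _) ?_, ?_⟩
  · have := mul_nonneg (show 0 ≤ p - 3 by linarith) (show 0 ≤ b ^ 2 + 4 * b by positivity)
    linarith
  obtain ⟨q, rfl⟩ : ∃ q, p = q + 1 := ⟨p - 1, by ring⟩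
  obtain ⟨u, rfl⟩ : ∃ u, b = u + 1 := ⟨b - 1, by ring⟩
  have hq : 2 ≤ q := by linarith
  have hx : 2 * (q + 1) * (q * u - 1) ≤ 1 := by
    have : q * u - 1 ≤ d - (q + 1) := by linarith
    have := mul_le_mul_of_nonneg_left this (show 0 ≤ 2 * (q + 1) by linarith)
    linarith
  suffices 0 ≤ 18 + 28 * u - 16 * (q * u) - 18 * u * (q * u) + 24 * u ^ 2 -
      (q - 2) * u * (u ^ 2 * (6 + u)) by linarith
  rcases le_total u 0 with h | h
  · have f1 : -1 ≤ (q + 1) * u := by linarith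
    have f2 : 0 ≤ (q - 2) * -u * (u ^ 2 * (6 + u)) := mul_nonneg (mul_nonneg (by linarith)
      (by linarith)) (mul_nonneg (sq_nonneg _) (by linarith))
    have f3 : -1 ≤ 3 * u := by nlinarith
    have f4 : q * u * u ≤ 1 := by nlinarith
    have f5 : q * u ≤ 2 * u := mul_le_mul_of_nonpos_right hq h
    nlinarith [sq_nonneg u]
  · have hqu : 0 ≤ q * u := mul_nonneg (by linarith) h
    have hz : q * u ≤ 7 / 6 := by nlinarith
    have huz : 2 * u ≤ q * u := mul_le_mul_of_nonneg_right hq h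
    have f1 : (q - 2) * u * (u ^ 2 * (6 + u)) ≤ 7 / 6 * (u ^ 2 * (6 + u)) :=
      mul_le_mul_of_nonneg_right (by linarith) (by positivity)
    have f2 := mul_nonneg h (sub_nonneg.2 hz)
    have f3 : 0 ≤ u ^ 2 * (1 - u) := mul_nonneg (sq_nonneg _) (by linarith)
    have f4 := sq_nonneg u
    rcases le_total (q * u) 1 with h1 | h1
    · linarith
    · have f6 : 16 * (q * u - 1) ≤ 2 + 7 * u := by
        refine le_of_mul_le_mul_left ?_ (show 0 < q + 1 by linarith)
        linarith
      linarith

lemma balanced_identity (p b y : ℝ) {d s₂ s₃ s₄ : ℝ} (hsum : (p - 1) * b + y = d)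
    (hs₂ : s₂ = (p - 1) * (p - 1 - 1) * b ^ 2 + 2 * (p - 1) * b * y)
    (hs₃ : s₃ = (p - 1) * (p - 1 - 1) * (p - 1 - 2) * b ^ 3 + 3 * (p - 1) * (p - 1 - 1) * b ^ 2 * y)
    (hs₄ : s₄ = (p - 1) * (p - 1 - 1) * (p - 1 - 2) * (p - 1 - 3) * b ^ 4 +
      4 * (p - 1) * (p - 1 - 1) * (p - 1 - 2) * b ^ 3 * y) :
    8 * (2 * b + 1) * (s₄ - 6 * ((p - 1) * (p - 2)) * s₂ + 8 * p * ((p - 1) * (p - 2)) * d -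
      3 * (p + 1) * p * ((p - 1) * (p - 2))) =
    8 * (5 * p - 3 - (p - 3) * (3 * b ^ 2 + 2 * b)) *
      (3 * ((p - 1) * (p - 2)) * d - 2 * p * ((p - 1) * (p - 2)) - s₃) -
    (b - 1) ^ 2 * ((p - 3) * (b ^ 2 + 4 * b) + 7 * p - 9) *
      (8 * ((p - 1) * (p - 2)) * (d - p)) := by
  subst hs₂ hs₃ hs₄ hsum
  ring

end ElementarySymmetric

section ElementarySymmetric

lemma link_bound_four {p d δ s₂ s₃ s₄ : ℝ} (hp : 3 ≤ p) (hd : 0 ≤ d) (hδ : 0 ≤ δ)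
    (hs₃ : s₃ = 3 * ((p - 1) * (p - 2)) * d - 2 * p * ((p - 1) * (p - 2)) - δ)
    (hs₃0 : 0 ≤ s₃) (hs₄0 : 0 ≤ s₄)
    (hgood : 2 * s₂ ^ 2 - d ^ 2 * s₂ ≤ d * s₃) (hmm : 3 * s₃ ^ 2 ≤ s₂ * (d * s₃ + 2 * s₄))
    (hdp : 2 * p * (d - p) ≤ 1) (hdδ : 2 * ((p - 1) * (p - 2)) * (d - p) ≤ δ)
    (hind₃ : ∀ b y, 0 ≤ y → y ≤ b → (p - 1) * b + y = d →
      s₂ = (p - 1) * (p - 1 - 1) * b ^ 2 + 2 * (p - 1) * b * y →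
      (p - 1) * (p - 1 - 1) * (p - 1 - 2) * b ^ 3 + 3 * (p - 1) * (p - 1 - 1) * b ^ 2 * y ≤ s₃)
    (hind₄ : ∀ b y, 0 ≤ y → y ≤ b → (p - 1) * b + y = d →
      s₂ = (p - 1) * (p - 1 - 1) * b ^ 2 + 2 * (p - 1) * b * y →
      (p - 1) * (p - 1 - 1) * (p - 1 - 2) * (p - 1 - 3) * b ^ 4 +
        4 * (p - 1) * (p - 1 - 1) * (p - 1 - 2) * b ^ 3 * y ≤ s₄) :
    p * ((p - 1) * (p - 2)) * (3 * (p + 1) - 8 * d) + δ ≤ s₄ - 6 * ((p - 1) * (p - 2)) * s₂ := by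
  have hl : 0 < (p - 1) * (p - 2) := mul_pos (by linarith) (by linarith)
  have hd3 : 2 * p ≤ 3 * d := by
    refine le_of_mul_le_mul_left ?_ hl
    linarith
  have hd0 : 0 < d := by linarith
  obtain ⟨b, hbd, hE₂, hE₃, hE₄, hb⟩ : ∃ b, 2 * b ≤ d ∧ s₂ ≤ d * (d - b) ∧
      d * (d - b) * (d - 2 * b) ≤ s₃ ∧ d * (d - b) * (d - 2 * b) * (d - 3 * b) ≤ s₄ ∧
      ((p - 1) * s₂ ≤ (p - 2) * d ^ 2 → d ≤ (p - 1) * b) := by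
    rcases le_total (d ^ 2 / 2) s₂ with h | h
    · have hs₂ : s₂ = d * (d - (d - s₂ / d)) := by field_simp; ring
      have hb : 2 * (d - s₂ / d) ≤ d := by
        have : d / 2 ≤ s₂ / d := by rw [le_div_iff₀ hd0]; linarith
        linarith
      obtain ⟨h3, h4⟩ := four_cliques_of_goodman_of_moon_moser hd0 hb hs₂ hs₄0 hgood hmm
      refine ⟨d - s₂ / d, hb, hs₂.le, h3, h4, fun h' => ?_⟩
      refine le_of_mul_le_mul_left ?_ hd0
      rw [hs₂] at h'
      linarith
    · refine ⟨d / 2, by linarith, by linarith, ?_, ?_, fun _ => by nlinarith⟩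
      · rw [show d - 2 * (d / 2) = 0 by ring]; linarith
      · rw [show d - 2 * (d / 2) = 0 by ring]; linarith
  have hls := mul_le_mul_of_nonneg_left hE₂ hl.le
  rcases le_total d (p - 1) with h1 | h1
  · have := density_bound_low_degree hp hbd h1 hd3 (by linarith)
    linarith
  by_cases h2 : (p - 1) * s₂ ≤ (p - 2) * d ^ 2
  · have := density_bound_high_degree hp hbd h1 hdp (hb h2)
    linarith
  have h3 : p * s₂ ≤ (p - 1) * d ^ 2 := by
    by_contra! h
    have g1 : (p - 2) * d ^ 2 ≤ p * (2 * s₂ - d ^ 2) := by linarith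
    have hd2 : 0 < d ^ 2 := pow_pos hd0 2
    have g2 : (p - 1) * d ^ 2 * ((p - 2) * d ^ 2) < p * s₂ * (p * (2 * s₂ - d ^ 2)) :=
      mul_lt_mul h g1 (mul_pos (by linarith) hd2)
        ((mul_pos (by linarith) hd2).le.trans h.le)
    have g3 := mul_le_mul_of_nonneg_left hgood (sq_nonneg p)
    have g4 : d * ((p - 1) * (p - 2) * d ^ 3) < d * (p ^ 2 * s₃) := by linarith
    have g5 := lt_of_mul_lt_mul_left g4 hd
    have g6 : 0 ≤ (p - 1) * (p - 2) * ((d - p) ^ 2 * (d + 2 * p)) :=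
      mul_nonneg hl.le (mul_nonneg (sq_nonneg _) (by linarith))
    rw [hs₃] at g5
    linarith [mul_nonneg (sq_nonneg p) hδ]
  obtain ⟨c, y, hy0, hyc, hsum, hs⟩ := exists_sizes (p := p - 1) (d := d) (s := s₂) (by linarith) hd
    (by linarith) (by linarith)
  have k3 := hind₃ c y hy0 hyc hsum hs
  have k4 := hind₄ c y hy0 hyc hsum hs
  obtain ⟨m1, m2⟩ := balanced_coefficient_bound hp h1 hdp hy0 hyc hsum
  have hid := balanced_identity p c y hsum hs rfl rfl
  set e₃ := (p - 1) * (p - 1 - 1) * (p - 1 - 2) * c ^ 3 + 3 * (p - 1) * (p - 1 - 1) * c ^ 2 * y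
  set e₄ := (p - 1) * (p - 1 - 1) * (p - 1 - 2) * (p - 1 - 3) * c ^ 4 +
        4 * (p - 1) * (p - 1 - 1) * (p - 1 - 2) * c ^ 3 * y
  set τ := (c - 1) ^ 2 * ((p - 3) * (c ^ 2 + 4 * c) + 7 * p - 9)
  set κ := 5 * p - 3 - (p - 3) * (3 * c ^ 2 + 2 * c)
  have hc : 0 ≤ c := hy0.trans hyc
  have r1 : δ ≤ 3 * ((p - 1) * (p - 2)) * d - 2 * p * ((p - 1) * (p - 2)) - e₃ := by linarith
  have r2 := mul_le_mul_of_nonneg_left r1 (show 0 ≤ κ by linarith)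
  have r3 := mul_le_mul_of_nonneg_left hdδ m1
  have r4 := mul_le_mul_of_nonneg_right m2 hδ
  have : δ ≤ e₄ - 6 * ((p - 1) * (p - 2)) * s₂ + 8 * p * ((p - 1) * (p - 2)) * d -
      3 * (p + 1) * p * ((p - 1) * (p - 2)) := by
    refine le_of_mul_le_mul_left ?_ (show 0 < 8 * (2 * c + 1) by linarith)
    rw [hid]
    linarith
  linarith

lemma triangle_defect_small {p y δ W s₂ s₃ : ℝ} (hp : 1 ≤ p) (hy0 : 0 ≤ y) (hy1 : y ≤ 1)
    (hW : W = p + y) (hs₂ : s₂ = p * (p - 1) + 2 * p * y)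
    (hs₃ : s₃ = p * (p - 1) * (p - 2) + 3 * p * (p - 1) * y - W * δ)
    (hgood : 2 * s₂ ^ 2 - W ^ 2 * s₂ ≤ W * s₃) : 2 * δ ≤ 1 := by
  have hW0 : 0 < W := by linarith
  refine le_of_mul_le_mul_left ?_ (pow_pos hW0 2)
  have h1 : W ^ 2 * δ ≤ 2 * (p * y) * (1 - y) ^ 2 := by
    have : W * s₃ + W ^ 2 * δ = W * (p * (p - 1) * (p - 2) + 3 * p * (p - 1) * y) := by
      rw [hs₃]; ring
    have h2 : W * (p * (p - 1) * (p - 2) + 3 * p * (p - 1) * y) - (2 * s₂ ^ 2 - W ^ 2 * s₂) =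
      2 * (p * y) * (1 - y) ^ 2 := by rw [hs₂, hW]; ring
    linarith
  have h3 : (1 - y) ^ 2 ≤ 1 := pow_le_one₀ (by linarith) (by linarith)
  have h4 := mul_le_mul_of_nonneg_left h3 (show 0 ≤ 2 * (p * y) by positivity)
  subst hW
  linarith [sq_nonneg (p - y)]

lemma four_clique_defect_small {p y δ W s₂ s₃ s₄ : ℝ} (hp : 3 ≤ p) (hy0 : 0 ≤ y) (hy1 : y ≤ 1)
    (hW : W = p + y) (hs₂ : s₂ = p * (p - 1) + 2 * p * y)
    (hs₄ : s₄ = p * (p - 1) * (p - 2) * (p - 3) + 4 * p * (p - 1) * (p - 2) * y - W * δ)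
    (hs₄0 : 0 ≤ s₄)
    (hgood : 2 * s₂ ^ 2 - W ^ 2 * s₂ ≤ W * s₃) (hmm : 3 * s₃ ^ 2 ≤ s₂ * (W * s₃ + 2 * s₄)) :
    p * δ ≤ (p - 1) * (p - 2) := by
  have hW0 : 0 < W := by linarith
  have hWs : s₂ = W * (W - (p + y ^ 2) / W) := by field_simp; rw [hs₂, hW]; ring
  obtain ⟨-, h⟩ := four_cliques_of_goodman_of_moon_moser hW0 (by
    rw [mul_div_assoc', div_le_iff₀ hW0, hW]; nlinarith) hWs hs₄0 hgood hmm
  have h2 : (W ^ 2 - (p + y ^ 2)) * (W ^ 2 - 2 * (p + y ^ 2)) * (W ^ 2 - 3 * (p + y ^ 2)) ≤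
      W ^ 2 * s₄ := by
    have e : W ^ 2 * (W * (W - (p + y ^ 2) / W) * (W - 2 * ((p + y ^ 2) / W)) *
      (W - 3 * ((p + y ^ 2) / W))) =
      (W ^ 2 - (p + y ^ 2)) * (W ^ 2 - 2 * (p + y ^ 2)) * (W ^ 2 - 3 * (p + y ^ 2)) := by
      field_simp
    rw [← e]
    exact mul_le_mul_of_nonneg_left h (sq_nonneg _)
  refine le_of_mul_le_mul_left ?_ (pow_pos hW0 3)
  obtain ⟨q, rfl⟩ : ∃ q, p = q + 3 := ⟨p - 3, by ring⟩
  have hq : 0 ≤ q := by linarith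
  have h3 : y * (1 - y) ^ 2 ≤ 4 / 27 := by
    have : 0 ≤ (y - 1 / 3) ^ 2 * (4 / 3 - y) := mul_nonneg (sq_nonneg _) (by linarith)
    linarith
  set K := 36 + 24 * y + q * (36 + 10 * y) + 8 * q ^ 2 with hK
  have h4 : W ^ 3 * δ ≤ (q + 3) * (y * (1 - y) ^ 2 * (K - 4 * y ^ 2)) := by
    subst hs₄ hs₂ hW
    linarith
  have h5 : y * (1 - y) ^ 2 * (K - 4 * y ^ 2) ≤ 4 / 27 * K :=
    mul_le_mul h3 (by linarith [sq_nonneg y]) (by nlinarith) (by norm_num)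
  have h6 : 4 / 27 * K ≤ (q + 1) * (q + 2) * (q + 3 + 3 * y) := by
    have e1 : 0 ≤ q * y := by positivity
    have e2 : 0 ≤ q ^ 2 * y := by positivity
    have e3 : 0 ≤ q ^ 3 := by positivity
    rw [hK]
    linarith [sq_nonneg q]
  have h7 := mul_le_mul_of_nonneg_left (h5.trans h6) (sq_nonneg (q + 3))
  have h8 : 0 ≤ (q + 1) * (q + 2) * (3 * (q + 3) * y ^ 2 + y ^ 3) := by positivity
  have h9 := mul_le_mul_of_nonneg_left h4 (show 0 ≤ q + 3 by linarith)
  have h10 : (q + 3) ^ 2 * ((q + 1) * (q + 2) * (q + 3 + 3 * y)) +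
      (q + 1) * (q + 2) * (3 * (q + 3) * y ^ 2 + y ^ 3) = (q + 1) * (q + 2) * W ^ 3 := by
    rw [hW]; ring
  linarith

lemma critical_three_contradiction {p y δ W s₂ s₃ s₄ : ℝ} (hp : 2 ≤ p) (hy0 : 0 < y) (hy1 : y ≤ 1)
    (hW : W = p + y) (hδ : 0 < δ) (hs₂ : s₂ = p * (p - 1) + 2 * p * y)
    (hs₃ : s₃ = p * (p - 1) * (p - 2) + 3 * p * (p - 1) * y - W * δ)
    (hup : s₄ ≤ 3 * (p - 1) * W * s₂ + 3 * (p - 1) * s₃ - 2 * W * s₃ +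
      3 * (-p * (p - 1) - δ) * s₂)
    (hlow : 3 * (p - 1) * (p - 2) * s₂ - 2 * p * (p - 1) * (p - 2) * W - (4 * p - 6) * δ * W ≤ s₄) :
    False := by
  have h : 0 < δ * (p * y + 3 * y - 2 * y ^ 2) := mul_pos hδ (by nlinarith)
  subst hs₃ hs₂ hW
  linarith

lemma critical_four_contradiction {p y δ W s₂ s₃ s₄ s₅ : ℝ} (hp : 3 ≤ p) (hy0 : 0 < y) (hy1 : y < 1)
    (hW : W = p + y) (hδ : 0 < δ) (hs₂ : s₂ = p * (p - 1) + 2 * p * y)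
    (hs₄ : s₄ = p * (p - 1) * (p - 2) * (p - 3) + 4 * p * (p - 1) * (p - 2) * y - W * δ)
    (hup : s₅ ≤ 6 * ((p - 1) * (p - 2)) * W * s₂ + 6 * ((p - 1) * (p - 2)) * s₃ - 3 * W * s₄ +
      4 * (-2 * p * ((p - 1) * (p - 2)) - δ) * s₂)
    (hlow : 6 * ((p - 1) * (p - 2)) * s₃ + 3 * p * (p + 1) * ((p - 1) * (p - 2)) * W -
      8 * p * ((p - 1) * (p - 2)) * s₂ + δ * W ≤ s₅) :
    False := by
  have h : 0 < δ * (p * (p - 3) + 2 * p * y + y - 3 * y ^ 2) := mul_pos hδ (by nlinarith)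
  subst hs₄ hs₂ hW
  linarith

end ElementarySymmetric

section Critical

variable {ι : Type*} [Fintype ι]

/-- The size of the `p` large parts of a complete multipartite graph of unit weight having one
smaller part, where `γ` is the edge density. -/
noncomputable def partSize (p γ : ℝ) : ℝ := (1 + √(1 - (p + 1) / p * γ)) / (p + 1)

lemma hasDerivAt_partSize {p γ : ℝ} (hp : 0 < p) (hγ : γ < p / (p + 1)) :
    HasDerivAt (partSize p) (-1 / (2 * p * ((p + 1) * partSize p γ - 1))) γ := by
  have h0 : 0 < 1 - (p + 1) / p * γ := by
    rw [lt_div_iff₀ (by linarith)] at hγ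
    have : (p + 1) / p * γ < 1 := by rw [div_mul_eq_mul_div, div_lt_one hp]; linarith
    linarith
  have h1 : HasDerivAt (fun γ => 1 - (p + 1) / p * γ) (-((p + 1) / p)) γ := by
    simpa using ((hasDerivAt_id γ).const_mul ((p + 1) / p)).const_sub 1
  have h2 := ((h1.sqrt h0.ne').const_add 1).div_const (p + 1)
  have h3 : (p + 1) * partSize p γ - 1 = √(1 - (p + 1) / p * γ) := by
    unfold partSize; field_simp; ring
  have h4 := Real.sqrt_pos.2 h0
  refine HasDerivAt.congr_deriv (f := partSize p) h2 ?_
  rw [h3]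
  field_simp

lemma hasDerivAt_partSize_pow {p γ c : ℝ} (q : ℕ) (hp : 0 < p) (hγ : γ < p / (p + 1)) :
    HasDerivAt (fun γ => p * c * partSize p γ ^ (q + 1) *
        (1 - (q + 1) * ((p + 1) * partSize p γ - 1)))
      (c * (q + 1) * (q + 2) / 2 * partSize p γ ^ q) γ := by
  have h := hasDerivAt_partSize hp hγ
  have h0 : 0 < (p + 1) * partSize p γ - 1 := by
    have h3 : (p + 1) * partSize p γ - 1 = √(1 - (p + 1) / p * γ) := by
      unfold partSize; field_simp; ring
    rw [h3, Real.sqrt_pos]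
    rw [lt_div_iff₀ (by linarith)] at hγ
    have : (p + 1) / p * γ < 1 := by rw [div_mul_eq_mul_div, div_lt_one hp]; linarith
    linarith
  have h1 := ((h.pow (q + 1)).const_mul (p * c)).mul
    ((((h.const_mul (p + 1)).sub_const 1).const_mul ((q : ℝ) + 1)).const_sub 1)
  refine h1.congr_deriv ?_
  simp only [Nat.add_sub_cancel, Pi.pow_apply]
  push_cast
  set B := partSize p γ
  field_simp
  ring

lemma partSize_eq {p b y : ℝ} (hp : 1 ≤ p) (hyb : y ≤ b) (hsum : p * b + y = 1) :
    partSize p (p * (p - 1) * b ^ 2 + 2 * p * b * y) = b := by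
  have h : 1 - (p + 1) / p * (p * (p - 1) * b ^ 2 + 2 * p * b * y) = (b - y) ^ 2 := by
    have : p ≠ 0 := by positivity
    obtain rfl : y = 1 - p * b := by linarith
    field_simp
    ring
  rw [partSize, h, Real.sqrt_sq (by linarith), div_eq_iff (by linarith)]
  linarith

lemma exists_normalized_critical (q : ℕ) {p c : ℝ} (hp : 1 ≤ p)
    (hend₀ : ∀ (a : ι → ι → ℝ) w, IsEdgeWeight a → (∀ i, 0 ≤ w i) → ∑ i, w i = 1 →
      cliqueSum a 2 w = 1 - 1 / p → c * (p - q - 1) * (1 / p) ^ (q + 1) ≤ cliqueSum a (q + 2) w)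
    (hend₁ : ∀ (a : ι → ι → ℝ) w, IsEdgeWeight a → (∀ i, 0 ≤ w i) → ∑ i, w i = 1 →
      cliqueSum a 2 w = 1 - 1 / (p + 1) → p * c * (1 / (p + 1)) ^ (q + 1) ≤ cliqueSum a (q + 2) w)
    {a₀ : ι → ι → ℝ} {w₀ : ι → ℝ} {b₀ y₀ : ℝ} (ha₀ : IsEdgeWeight a₀) (hw₀ : ∀ i, 0 ≤ w₀ i)
    (hy₀ : 0 ≤ y₀) (hyb₀ : y₀ ≤ b₀) (hsum₀ : p * b₀ + y₀ = ∑ i, w₀ i)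
    (hs₀ : cliqueSum a₀ 2 w₀ = p * (p - 1) * b₀ ^ 2 + 2 * p * b₀ * y₀)
    (hlt : cliqueSum a₀ (q + 2) w₀ < p * c * b₀ ^ (q + 1) * ((p - q - 1) * b₀ + (q + 2) * y₀)) :
    ∃ (a : ι → ι → ℝ) (w : ι → ℝ) (y δ : ℝ), IsEdgeWeight a ∧ (∀ i, 0 ≤ w i) ∧ 0 < y ∧ y < 1 ∧
      0 < δ ∧ ∑ i, w i = p + y ∧ cliqueSum a 2 w = p * (p - 1) + 2 * p * y ∧
      cliqueSum a (q + 2) w = p * c * (p - q - 1 + (q + 2) * y) - (p + y) * δ ∧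
      (∀ i, w i = 0 ∨ cliqueSum a (q + 1) (linkWeight a w i) =
        (q + 1) * c * cliqueSum a 1 (linkWeight a w i) - q * p * c - δ) ∧
      ∀ g : ι → ι → ℝ, (∀ i j, g i j = g j i) → (∀ i j, 0 ≤ g i j) →
        ∑ i, ∑ j, w i * w j * a i j * g i j * cliqueSum a q (linkWeight a (linkWeight a w i) j) ≤
          c * ∑ i, ∑ j, w i * w j * a i j * g i j := by
  have hp0 : 0 < p := by linarith
  have hb₀ : 0 ≤ b₀ := hy₀.trans hyb₀
  have hW : 0 < ∑ i, w₀ i := by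
    rw [← hsum₀]
    rcases hb₀.eq_or_lt with h | h
    · subst h
      have := cliqueSum_nonneg ha₀ (q + 2) hw₀
      simp at hlt
      linarith
    · positivity
  set W := ∑ i, w₀ i with hWdef
  set F : ℝ → ℝ := fun γ => p * c * partSize p γ ^ (q + 1) *
        (1 - (q + 1) * ((p + 1) * partSize p γ - 1)) with hF
  have hFe : ∀ b y, y ≤ b → p * b + y = 1 → F (p * (p - 1) * b ^ 2 + 2 * p * b * y) =
      p * c * b ^ (q + 1) * ((p - q - 1) * b + (q + 2) * y) := fun b y h h' => by
    simp only [hF]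
    rw [partSize_eq hp h h']
    obtain rfl : y = 1 - p * b := by linarith
    ring
  have hsum1 : ∑ i, W⁻¹ * w₀ i = 1 := by
    rw [← mul_sum, ← hWdef, inv_mul_cancel₀ hW.ne']
  have hb1 : p * (W⁻¹ * b₀) + W⁻¹ * y₀ = 1 := by
    rw [← inv_mul_cancel₀ hW.ne', ← hsum₀]; ring
  have hs1 : cliqueSum a₀ 2 (fun i => W⁻¹ * w₀ i) =
      p * (p - 1) * (W⁻¹ * b₀) ^ 2 + 2 * p * (W⁻¹ * b₀) * (W⁻¹ * y₀) := by
    rw [cliqueSum_smul, hs₀]; ring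
  have hWi : 0 < W⁻¹ := inv_pos.2 hW
  have hp1 : (p + 1) ≠ 0 := by linarith
  have hF₀ : F (1 - 1 / p) = c * (p - q - 1) * (1 / p) ^ (q + 1) := by
    have h := hFe (1 / p) 0 (by positivity) (by field_simp; ring)
    rw [show p * (p - 1) * (1 / p) ^ 2 + 2 * p * (1 / p) * 0 = 1 - 1 / p by field_simp; ring] at h
    rw [h]
    field_simp
    ring
  have hF₁ : F (1 - 1 / (p + 1)) = p * c * (1 / (p + 1)) ^ (q + 1) := by
    have h := hFe (1 / (p + 1)) (1 / (p + 1)) le_rfl (by field_simp)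
    rw [show p * (p - 1) * (1 / (p + 1)) ^ 2 + 2 * p * (1 / (p + 1)) * (1 / (p + 1)) =
      1 - 1 / (p + 1) by field_simp; ring] at h
    rw [h]
    field_simp
    ring
  have hγ : 1 - 1 / (p + 1) = p / (p + 1) := by field_simp; ring
  obtain ⟨a, w, ha, hw, hw1, hs₂, hlt', hvert, hedge⟩ := exists_critical (ι := ι) q (F := F)
    (F' := fun γ => c * (q + 1) * (q + 2) / 2 * partSize p γ ^ q) (γ₀ := 1 - 1 / p)
    (γ₁ := 1 - 1 / (p + 1))
    (by
      simp only [hF]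
      unfold partSize
      fun_prop)
    (fun γ hγ' => hasDerivAt_partSize_pow q hp0 (hγ ▸ hγ'.2))
    (by
      rintro ⟨a, w⟩ ⟨ha, hw, hw1, -⟩ (h | h)
      · simp only at h ⊢
        rw [h, hF₀]
        exact hend₀ a w ha hw hw1 h
      · simp only at h ⊢
        rw [h, hF₁]
        exact hend₁ a w ha hw hw1 h)
    (x₀ := (a₀, fun i => W⁻¹ * w₀ i))
    (by
      refine ⟨ha₀, fun i => mul_nonneg hWi.le (hw₀ i), hsum1, ?_⟩
      simp only
      rw [hs1]
      have hu0 : 0 ≤ W⁻¹ * y₀ := mul_nonneg hWi.le hy₀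
      have huv : W⁻¹ * y₀ ≤ W⁻¹ * b₀ := mul_le_mul_of_nonneg_left hyb₀ hWi.le
      generalize W⁻¹ * y₀ = u at *
      generalize W⁻¹ * b₀ = v at *
      obtain rfl : u = 1 - p * v := by linarith
      constructor
      · have h2 : 0 ≤ (1 - p * v) * ((p + 1) * v - (1 - 1 / p)) := by
          have : 0 < 1 / p := by positivity
          exact mul_nonneg hu0 (by linarith)
        have h3 : p * (1 / p) = 1 := by field_simp
        linear_combination h2 - v * h3
      · rw [hγ, le_div_iff₀ (by linarith)]
        have := mul_nonneg hp0.le (sq_nonneg ((p + 1) * v - 1))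
        linarith)
    (by
      simp only
      rw [hs1, hFe _ _ (mul_le_mul_of_nonneg_left hyb₀ hWi.le) hb1, cliqueSum_smul]
      have := mul_lt_mul_of_pos_left hlt (pow_pos hWi (q + 2))
      refine this.trans_eq ?_
      ring)
  obtain ⟨b, y, hy0, hyb, hby, hγb⟩ := exists_sizes (p := p) (d := 1) (s := cliqueSum a 2 w) hp
    zero_le_one
    (by
      have h := mul_le_mul_of_nonneg_left hs₂.1.le hp0.le
      have h3 : p * (1 / p) = 1 := by field_simp
      linarith)
    (by
      have h := hs₂.2.le
      rw [hγ, le_div_iff₀ (by linarith)] at h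
      linarith)
  have hb0 : 0 < b := by
    rcases (hy0.trans hyb).eq_or_lt with h | h
    · subst h
      linarith
    · exact h
  have hy : 0 < y := by
    refine hy0.lt_of_ne fun h => ?_
    subst h
    have : b = 1 / p := by field_simp; linarith
    refine hs₂.1.ne ?_
    rw [hγb, this]
    field_simp
    ring
  have hylt : y < b := by
    refine hyb.lt_of_ne fun h => ?_
    subst h
    have : y = 1 / (p + 1) := by field_simp; linarith
    refine hs₂.2.ne ?_
    rw [hγb, this]
    field_simp
    ring
  have hB : partSize p (cliqueSum a 2 w) = b := by rw [hγb, partSize_eq hp hyb hby]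
  have hFb : F (cliqueSum a 2 w) = p * c * b ^ (q + 1) * ((p - q - 1) * b + (q + 2) * y) := by
    rw [hγb, hFe b y hyb hby]
  rw [hFb] at hlt'
  simp only [hB] at hvert hedge
  have hlink : ∀ (v : ι → ℝ) i, linkWeight a (fun j => b⁻¹ * v j) i =
      fun j => b⁻¹ * linkWeight a v i j := fun v i => by
    funext j; simp only [linkWeight]; ring
  have hbi : 0 < b⁻¹ := inv_pos.2 hb0
  have hbb : b⁻¹ * b = 1 := inv_mul_cancel₀ hb0.ne'
  have hbp : p + b⁻¹ * y = b⁻¹ := by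
    linear_combination b⁻¹ * hby - p * hbb
  have hbr : ∀ r, b⁻¹ ^ r * b ^ r = 1 := fun r => by rw [← mul_pow, hbb, one_pow]
  set S := cliqueSum a (q + 2) w with hS
  set δ := b⁻¹ ^ (q + 1) * (p * c * b ^ (q + 1) * ((p - q - 1) * b + (q + 2) * y) - S) with hδ
  refine ⟨a, fun i => b⁻¹ * w i, b⁻¹ * y, δ, ha,
    fun i => mul_nonneg hbi.le (hw i), mul_pos hbi hy, ?_, mul_pos (pow_pos hbi _)
    (sub_pos.2 hlt'), ?_, ?_, ?_, ?_, ?_⟩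
  · rw [← hbb]; exact mul_lt_mul_of_pos_left hylt hbi
  · rw [← mul_sum, hw1, mul_one, hbp]
  · rw [cliqueSum_smul, hγb]
    linear_combination (p * (p - 1) * (b⁻¹ * b + 1) + 2 * p * b⁻¹ * y) * hbb
  · rw [cliqueSum_smul, hbp, ← hS, hδ]
    linear_combination p * c * b⁻¹ * ((p - q - 1) * b + (q + 2) * y) * hbr (q + 1) +
      p * c * (p - q - 1) * hbb
  · intro i
    refine (hvert i).imp (fun h => by simp only [h, mul_zero]) fun h => ?_
    rw [hlink, cliqueSum_smul, cliqueSum_smul, hδ]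
    have h' : cliqueSum a (q + 1) (linkWeight a w i) =
        S + (q + 1) * c * b ^ q * (cliqueSum a 1 (linkWeight a w i) - cliqueSum a 2 w) := by
      refine mul_left_cancel₀ (show (q : ℝ) + 2 ≠ 0 by positivity) ?_
      linear_combination h
    rw [h', hγb]
    linear_combination (q + 1) * c * b⁻¹ * (cliqueSum a 1 (linkWeight a w i) -
      (p * (p - 1) * b ^ 2 + 2 * p * b * y)) * hbr q - (q + 1) * c * (p * (p - 1) * b + 2 * p * y) *
      hbb + p * c * ((p - q - 1) * b + (q + 2) * y) * hbr (q + 1) - q * p * c * hby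
  · intro g hg hg0
    have h := hedge g hg hg0
    simp only [hlink, cliqueSum_smul]
    have e1 : ∑ i, ∑ j, b⁻¹ * w i * (b⁻¹ * w j) * a i j * g i j *
        (b⁻¹ ^ q * cliqueSum a q (linkWeight a (linkWeight a w i) j)) =
        b⁻¹ ^ (q + 2) * ∑ i, ∑ j, w i * w j * a i j * g i j *
        cliqueSum a q (linkWeight a (linkWeight a w i) j) := by
      simp only [mul_sum]
      exact sum_congr rfl fun i _ => sum_congr rfl fun j _ => by ring
    have e2 : ∑ i, ∑ j, b⁻¹ * w i * (b⁻¹ * w j) * a i j * g i j =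
        b⁻¹ ^ 2 * ∑ i, ∑ j, w i * w j * a i j * g i j := by
      simp only [mul_sum]
      exact sum_congr rfl fun i _ => sum_congr rfl fun j _ => by ring
    rw [e1, e2]
    generalize ∑ i, ∑ j, w i * w j * a i j * g i j *
        cliqueSum a q (linkWeight a (linkWeight a w i) j) = X at h ⊢
    generalize ∑ i, ∑ j, w i * w j * a i j * g i j = Y at h ⊢
    have h' : X ≤ c * b ^ q * Y := by
      refine le_of_mul_le_mul_left ?_ (show 0 < ((q : ℝ) + 2) * (q + 1) / 2 by positivity)
      linarith
    refine (mul_le_mul_of_nonneg_left h' (pow_pos hbi (q + 2)).le).trans_eq ?_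
    linear_combination b⁻¹ ^ 2 * c * Y * hbr q

end Critical

section CliqueDensity

variable {ι : Type*} [Fintype ι]

/-- A lower bound for the `r`-clique sum in terms of the edge sum, for the weighted graphs whose
edge density allows `p` large parts and a smaller one. -/
def CliqueDensityBound (ι : Type*) [Fintype ι] (r : ℕ) (p c : ℝ) : Prop :=
  ∀ (a : ι → ι → ℝ) (w : ι → ℝ) (b y : ℝ), IsEdgeWeight a → (∀ i, 0 ≤ w i) → 0 ≤ y → y ≤ b →
    p * b + y = ∑ i, w i → cliqueSum a 2 w = p * (p - 1) * b ^ 2 + 2 * p * b * y →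
    p * c * b ^ (r - 1) * ((p - r + 1) * b + r * y) ≤ cliqueSum a r w

variable {a : ι → ι → ℝ} {w : ι → ℝ}

lemma mul_cliqueSum_link_le {q : ℕ} {c : ℝ} (ha : IsEdgeWeight a)
    (hedge : ∀ g : ι → ι → ℝ, (∀ i j, g i j = g j i) → (∀ i j, 0 ≤ g i j) →
      ∑ i, ∑ j, w i * w j * a i j * g i j * cliqueSum a q (linkWeight a (linkWeight a w i) j) ≤
        c * ∑ i, ∑ j, w i * w j * a i j * g i j) (k : ι) :
    w k * cliqueSum a (q + 1) (linkWeight a w k) ≤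
      w k * (c * cliqueSum a 1 (linkWeight a w k)) := by
  classical
  have key : ∀ f : ι → ι → ℝ, (∀ i j, f i j = f j i) →
      ∑ i, ∑ j, f i j * ((if i = k then 1 else 0) + if j = k then 1 else 0) =
        2 * ∑ j, f k j := fun f hf => by
    have h1 : ∑ i, ∑ j, f i j * (if i = k then 1 else 0) = ∑ j, f k j := by
      rw [sum_eq_single k (fun i _ hi => by simp [hi]) (by simp)]
      simp
    have h2 : ∑ i, ∑ j, f i j * (if j = k then 1 else 0) = ∑ j, f k j := by
      rw [sum_comm, sum_eq_single k (fun i _ hi => by simp [hi]) (by simp)]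
      simp [hf k]
    simp only [mul_add, sum_add_distrib]
    rw [h1, h2]
    ring
  have h := hedge (fun i j => (if i = k then 1 else 0) + if j = k then 1 else 0)
    (fun i j => add_comm _ _) (fun i j => by positivity)
  have e1 := key (fun i j => w i * w j * a i j *
    cliqueSum a q (linkWeight a (linkWeight a w i) j))
    (fun i j => by rw [linkWeight_comm, ha.symm]; ring)
  have e2 := key (fun i j => w i * w j * a i j) (fun i j => by rw [ha.symm]; ring)
  have e3 : ∑ j, w k * w j * a k j = w k * cliqueSum a 1 (linkWeight a w k) := by
    rw [cliqueSum_one, mul_sum]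
    exact sum_congr rfl fun j _ => by simp only [linkWeight]; ring
  rw [sum_link_cliqueSum] at e1
  rw [e3] at e2
  have e1' : ∑ i, ∑ j, w i * w j * a i j * ((if i = k then 1 else 0) + if j = k then 1 else 0) *
      cliqueSum a q (linkWeight a (linkWeight a w i) j) =
      2 * (w k * cliqueSum a (q + 1) (linkWeight a w k)) := by
    rw [← e1]
    exact sum_congr rfl fun i _ => sum_congr rfl fun j _ => by ring
  rw [e1', e2] at h
  linarith

lemma sum_codegree_mul_le {q : ℕ} {c : ℝ} (ha : IsEdgeWeight a) (hw : ∀ i, 0 ≤ w i)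
    (hedge : ∀ g : ι → ι → ℝ, (∀ i j, g i j = g j i) → (∀ i j, 0 ≤ g i j) →
      ∑ i, ∑ j, w i * w j * a i j * g i j * cliqueSum a q (linkWeight a (linkWeight a w i) j) ≤
        c * ∑ i, ∑ j, w i * w j * a i j * g i j) :
    (∑ i, w i) * cliqueSum a (q + 2) w - 2 * ∑ i, w i * cliqueSum a 1 (linkWeight a w i) *
        cliqueSum a (q + 1) (linkWeight a w i) +
      ∑ i, ∑ j, w i * w j * a i j * (cliqueSum a 1 (linkWeight a (linkWeight a w i) j) *
        cliqueSum a q (linkWeight a (linkWeight a w i) j)) ≤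
    c * ((∑ i, w i) * cliqueSum a 2 w - 2 * ∑ i, w i * cliqueSum a 1 (linkWeight a w i) ^ 2 +
      cliqueSum a 3 w) := by
  have hco := hedge (coLinkSum a w) (coLinkSum_comm a w) (coLinkSum_nonneg ha hw)
  have e : ∀ v : ι → ℝ, cliqueSum a 0 v = 1 := fun _ => rfl
  have h0 := sum_coLinkSum_mul (w := w) ha 0
  have h1 : ∑ i, w i * cliqueSum a 1 (linkWeight a w i) ^ 2 =
      ∑ i, w i * cliqueSum a 1 (linkWeight a w i) * cliqueSum a 1 (linkWeight a w i) :=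
    sum_congr rfl fun i _ => by ring
  simp only [e, mul_one, zero_add, ← cliqueSum_add_two a 1 w] at h0
  rwa [sum_coLinkSum_mul ha, h0, ← h1] at hco

lemma goodman_link (ha : IsEdgeWeight a) (hw : ∀ i, 0 ≤ w i) (i : ι) :
    2 * cliqueSum a 2 (linkWeight a w i) ^ 2 - cliqueSum a 1 (linkWeight a w i) ^ 2 *
      cliqueSum a 2 (linkWeight a w i) ≤
    cliqueSum a 1 (linkWeight a w i) * cliqueSum a 3 (linkWeight a w i) := by
  have := goodman ha (linkWeight_nonneg ha hw i)
  rwa [← cliqueSum_one a] at this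

lemma moon_moser_link (ha : IsEdgeWeight a) (hw : ∀ i, 0 ≤ w i) (i : ι) :
    3 * cliqueSum a 3 (linkWeight a w i) ^ 2 ≤ cliqueSum a 2 (linkWeight a w i) *
      (cliqueSum a 1 (linkWeight a w i) * cliqueSum a 3 (linkWeight a w i) +
        2 * cliqueSum a 4 (linkWeight a w i)) := by
  have := moon_moser ha (linkWeight_nonneg ha hw i)
  rwa [← cliqueSum_one a] at this

lemma cliqueDensityBound_three_step {p : ℝ} (hp : 2 ≤ p)
    (hp' : p = 2 ∨ 3 ≤ p) (ih : CliqueDensityBound ι 3 (p - 1) (p - 1 - 1)) :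
    CliqueDensityBound ι 3 p (p - 1) := by
  intro a₀ w₀ b₀ y₀ ha₀ hw₀ hy₀ hyb₀ hsum₀ hs₀
  by_contra! hlt
  have good1 : ∀ (a : ι → ι → ℝ) w, IsEdgeWeight a → (∀ i, 0 ≤ w i) → ∑ i, w i = 1 →
      2 * cliqueSum a 2 w ^ 2 - cliqueSum a 2 w ≤ cliqueSum a 3 w := fun a w ha hw h1 => by
    have := goodman ha hw
    rw [h1] at this
    linarith
  obtain ⟨a, w, y, δ, ha, hw, hy0, hy1, hδ, hsum, hs₂, hs₃, hvert, hedge⟩ :=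
    exists_normalized_critical (ι := ι) 1 (p := p) (c := p - 1) (by linarith)
      (fun a w ha hw h1 h2 => by
        refine le_trans ?_ (good1 a w ha hw h1)
        rw [h2]
        apply le_of_eq
        push_cast
        field_simp
        ring)
      (fun a w ha hw h1 h2 => by
        refine le_trans ?_ (good1 a w ha hw h1)
        rw [h2]
        apply le_of_eq
        have : p + 1 ≠ 0 := by linarith
        push_cast
        field_simp
        ring)
      ha₀ hw₀ hy₀ hyb₀ hsum₀ hs₀
      (by
        refine hlt.trans_eq ?_
        push_cast
        ring)
  push_cast at hs₃ hvert
  replace hs₃ : cliqueSum a 3 w = p * (p - 1) * (p - 2) + 3 * p * (p - 1) * y -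
    (∑ i, w i) * δ := by rw [hsum]; exact hs₃.trans (by ring)
  have hsmall := triangle_defect_small (by linarith) hy0.le hy1.le hsum hs₂ hs₃ (goodman ha hw)
  have hlow : ∀ i, w i * (3 * (p - 1) * (p - 2) * cliqueSum a 1 (linkWeight a w i) -
      2 * p * (p - 1) * (p - 2) - (4 * p - 6) * δ) ≤ w i * cliqueSum a 3 (linkWeight a w i) := by
    intro i
    rcases (hw i).eq_or_lt with h | h
    · simp [← h]
    have hL := linkWeight_nonneg ha hw i
    have hf := (hvert i).resolve_left h.ne'
    have hle := le_of_mul_le_mul_left (mul_cliqueSum_link_le ha hedge i) h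
    refine mul_le_mul_of_nonneg_left ?_ h.le
    rcases hp' with rfl | hp3
    · linarith [cliqueSum_nonneg ha 3 hL]
    · refine link_bound_three hp3 (cliqueSum_nonneg ha 1 hL) hδ.le
        (s₂ := cliqueSum a 2 (linkWeight a w i)) (hf.trans (by ring))
        (cliqueSum_nonneg ha 2 hL) (goodman_link ha hw i) (by linarith) ?_ (by linarith)
      intro b y hy hyb hs h2
      refine le_trans (le_of_eq ?_) (ih a _ b y ha hL hy hyb (by rw [hs, cliqueSum_one]) h2)
      push_cast
      ring
  have hlow' := sum_le_sum fun i (_ : i ∈ univ) => hlow i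
  rw [← cliqueSum_succ] at hlow'
  have e1 : ∑ i, w i * (3 * (p - 1) * (p - 2) * cliqueSum a 1 (linkWeight a w i) -
      2 * p * (p - 1) * (p - 2) - (4 * p - 6) * δ) = 3 * (p - 1) * (p - 2) * cliqueSum a 2 w -
      2 * p * (p - 1) * (p - 2) * (∑ i, w i) - (4 * p - 6) * δ * (∑ i, w i) := by
    rw [cliqueSum_succ, mul_sum, mul_sum, mul_sum, ← sum_sub_distrib, ← sum_sub_distrib]
    exact sum_congr rfl fun i _ => by ring
  have hco := sum_codegree_mul_le ha hw hedge
  have e2 : ∑ i, w i * cliqueSum a 1 (linkWeight a w i) * cliqueSum a 2 (linkWeight a w i) =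
      2 * (p - 1) * (∑ i, w i * cliqueSum a 1 (linkWeight a w i) ^ 2) -
        (p * (p - 1) + δ) * cliqueSum a 2 w := by
    rw [cliqueSum_succ, mul_sum, mul_sum, ← sum_sub_distrib]
    refine sum_congr rfl fun i _ => ?_
    rcases hvert i with h | h
    · simp [h]
    · rw [show (2 : ℕ) = 1 + 1 from rfl, h]; ring
  have hc := le_sum_sq_codegree ha hw
  rw [e1] at hlow'
  rw [e2] at hc
  rw [show 1 + 1 = 2 from rfl, show 1 + 2 = 3 from rfl, e2] at hco
  refine critical_three_contradiction hp hy0 hy1.le hsum hδ hs₂ hs₃ (s₄ := cliqueSum a 4 w) ?_ hlow'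
  linarith

lemma cliqueDensityBound_four_step {p : ℝ} (hp : 3 ≤ p)
    (ih₃ : CliqueDensityBound ι 3 (p - 1) (p - 1 - 1))
    (ih₄ : CliqueDensityBound ι 4 (p - 1) ((p - 1 - 1) * (p - 1 - 2))) :
    CliqueDensityBound ι 4 p ((p - 1) * (p - 2)) := by
  intro a₀ w₀ b₀ y₀ ha₀ hw₀ hy₀ hyb₀ hsum₀ hs₀
  by_contra! hlt
  have four1 : ∀ (a : ι → ι → ℝ) w (β : ℝ), IsEdgeWeight a → (∀ i, 0 ≤ w i) → ∑ i, w i = 1 →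
      2 * β ≤ 1 → cliqueSum a 2 w = 1 - β →
      (1 - β) * (1 - 2 * β) * (1 - 3 * β) ≤ cliqueSum a 4 w := fun a w β ha hw h1 hβ h2 => by
    have hg := goodman ha hw
    have hm := moon_moser ha hw
    rw [h1] at hg hm
    have := (four_cliques_of_goodman_of_moon_moser zero_lt_one hβ (h2.trans (by ring))
      (cliqueSum_nonneg ha 4 hw) hg hm).2
    linarith
  obtain ⟨a, w, y, δ, ha, hw, hy0, hy1, hδ, hsum, hs₂, hs₄, hvert, hedge⟩ :=
    exists_normalized_critical (ι := ι) 2 (p := p) (c := (p - 1) * (p - 2)) (by linarith)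
      (fun a w ha hw h1 h2 => by
        refine le_trans ?_ (four1 a w (1 / p) ha hw h1
          (by rw [mul_one_div, div_le_one (by linarith)]; linarith) h2)
        apply le_of_eq
        push_cast
        field_simp
        ring)
      (fun a w ha hw h1 h2 => by
        have hp1 : 0 < p + 1 := by linarith
        refine le_trans ?_ (four1 a w (1 / (p + 1)) ha hw h1
          (by rw [mul_one_div, div_le_one hp1]; linarith) h2)
        apply le_of_eq
        push_cast
        field_simp
        ring)
      ha₀ hw₀ hy₀ hyb₀ hsum₀ hs₀
      (by
        refine hlt.trans_eq ?_
        push_cast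
        ring)
  push_cast at hs₄ hvert
  replace hs₄ : cliqueSum a 4 w = p * (p - 1) * (p - 2) * (p - 3) +
    4 * p * (p - 1) * (p - 2) * y - (∑ i, w i) * δ := by rw [hsum]; exact hs₄.trans (by ring)
  have hsmall := four_clique_defect_small hp hy0.le hy1.le hsum hs₂ hs₄
    (cliqueSum_nonneg ha 4 hw) (goodman ha hw) (moon_moser ha hw)
  have hc0 : 0 < (p - 1) * (p - 2) := mul_pos (by linarith) (by linarith)
  have hlow : ∀ i, w i * (p * ((p - 1) * (p - 2)) *
      (3 * (p + 1) - 8 * cliqueSum a 1 (linkWeight a w i)) + δ) ≤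
      w i * (cliqueSum a 4 (linkWeight a w i) -
        6 * ((p - 1) * (p - 2)) * cliqueSum a 2 (linkWeight a w i)) := by
    intro i
    rcases (hw i).eq_or_lt with h | h
    · simp [← h]
    have hL := linkWeight_nonneg ha hw i
    have hf := (hvert i).resolve_left h.ne'
    have hle := le_of_mul_le_mul_left (mul_cliqueSum_link_le ha hedge i) h
    refine mul_le_mul_of_nonneg_left ?_ h.le
    have hdδ : 2 * ((p - 1) * (p - 2)) * (cliqueSum a 1 (linkWeight a w i) - p) ≤ δ := by
      linarith
    refine link_bound_four hp (cliqueSum_nonneg ha 1 hL) hδ.le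
      (s₃ := cliqueSum a 3 (linkWeight a w i)) (hf.trans (by ring))
      (cliqueSum_nonneg ha 3 hL) (cliqueSum_nonneg ha 4 hL) (goodman_link ha hw i)
      (moon_moser_link ha hw i) ?_ hdδ ?_ ?_
    · refine le_of_mul_le_mul_left ?_ hc0
      have := mul_le_mul_of_nonneg_left hdδ (show 0 ≤ p by linarith)
      linarith
    · intro b y hy hyb hs h2
      refine le_trans (le_of_eq ?_) (ih₃ a _ b y ha hL hy hyb (by rw [hs, cliqueSum_one]) h2)
      push_cast
      ring
    · intro b y hy hyb hs h2
      refine le_trans (le_of_eq ?_) (ih₄ a _ b y ha hL hy hyb (by rw [hs, cliqueSum_one]) h2)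
      push_cast
      ring
  have hlow' := sum_le_sum fun i (_ : i ∈ univ) => hlow i
  have e1 : ∑ i, w i * (p * ((p - 1) * (p - 2)) *
      (3 * (p + 1) - 8 * cliqueSum a 1 (linkWeight a w i)) + δ) =
      (3 * p * (p + 1) * ((p - 1) * (p - 2)) + δ) * (∑ i, w i) -
        8 * p * ((p - 1) * (p - 2)) * cliqueSum a 2 w := by
    rw [cliqueSum_succ, mul_sum, mul_sum, ← sum_sub_distrib]
    exact sum_congr rfl fun i _ => by ring
  have e1' : ∑ i, w i * (cliqueSum a 4 (linkWeight a w i) -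
        6 * ((p - 1) * (p - 2)) * cliqueSum a 2 (linkWeight a w i)) =
      cliqueSum a 5 w - 6 * ((p - 1) * (p - 2)) * cliqueSum a 3 w := by
    rw [cliqueSum_succ a 4, cliqueSum_succ a 2, mul_sum, ← sum_sub_distrib]
    exact sum_congr rfl fun i _ => by ring
  have hco := sum_codegree_mul_le ha hw hedge
  have e2 : ∑ i, w i * cliqueSum a 1 (linkWeight a w i) * cliqueSum a 3 (linkWeight a w i) =
      3 * ((p - 1) * (p - 2)) * (∑ i, w i * cliqueSum a 1 (linkWeight a w i) ^ 2) -
        (2 * p * ((p - 1) * (p - 2)) + δ) * cliqueSum a 2 w := by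
    rw [cliqueSum_succ, mul_sum, mul_sum, ← sum_sub_distrib]
    refine sum_congr rfl fun i _ => ?_
    rcases hvert i with h | h
    · simp [h]
    · rw [show (3 : ℕ) = 2 + 1 from rfl, h]; ring
  have hc := le_sum_codegree_mul ha hw
  rw [e1, e1'] at hlow'
  rw [e2] at hc
  rw [show 2 + 1 = 3 from rfl, show 2 + 2 = 4 from rfl, e2] at hco
  refine critical_four_contradiction hp hy0 hy1 hsum hδ hs₂ hs₄ (s₃ := cliqueSum a 3 w)
    (s₅ := cliqueSum a 5 w) ?_
    (by linarith)
  linarith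

lemma cliqueDensityBound_three {p : ℕ} (hp : 1 ≤ p) : CliqueDensityBound ι 3 p (p - 1) := by
  induction p, hp using Nat.le_induction with
  | base =>
    intro a w b y ha hw _ _ _ _
    simpa using cliqueSum_nonneg ha 3 hw
  | succ p hp ih =>
    have h1 : (1 : ℝ) ≤ p := by exact_mod_cast hp
    refine cliqueDensityBound_three_step (by push_cast; linarith) ?_ (by simpa using ih)
    rcases hp.eq_or_lt with rfl | h
    · exact Or.inl (by norm_num)
    · have h2 : (2 : ℝ) ≤ p := by exact_mod_cast h
      exact Or.inr (by push_cast; linarith)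

lemma cliqueDensityBound_four {p : ℕ} (hp : 1 ≤ p) :
    CliqueDensityBound ι 4 p ((p - 1) * (p - 2)) := by
  induction p, hp using Nat.le_induction with
  | base =>
    intro a w b y ha hw _ _ _ _
    simpa using cliqueSum_nonneg ha 4 hw
  | succ p hp ih =>
    rcases hp.eq_or_lt with rfl | h
    · intro a w b y ha hw _ _ _ _
      have := cliqueSum_nonneg ha 4 hw
      norm_num
      exact this
    · have h2 : (2 : ℝ) ≤ p := by exact_mod_cast h
      exact cliqueDensityBound_four_step (by push_cast; linarith)
        (by simpa using cliqueDensityBound_three hp) (by simpa using ih)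

end CliqueDensity

section CliqueCount

/-- The `r`-cliques of `G` inside `U`. -/
def cliquesIn {V : Type*} [DecidableEq V] (G : SimpleGraph V) [DecidableRel G.Adj] (r : ℕ)
    (U : Finset V) : Finset (Finset V) :=
  (U.powersetCard r).filter fun t => G.IsClique t

lemma mem_cliquesIn {V : Type*} [DecidableEq V] {G : SimpleGraph V} [DecidableRel G.Adj] {r : ℕ}
    {U t : Finset V} : t ∈ cliquesIn G r U ↔ (t ⊆ U ∧ #t = r) ∧ G.IsClique t := by
  rw [cliquesIn, mem_filter, mem_powersetCard]

lemma card_cliquesIn_succ {V : Type*} [DecidableEq V] (G : SimpleGraph V)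
    [DecidableRel G.Adj] (r : ℕ) (U : Finset V) :
    (r + 1) * #(cliquesIn G (r + 1) U) =
      ∑ i ∈ U, #(cliquesIn G r {j ∈ U | G.Adj i j}) := by
  have h : (r + 1) * #(cliquesIn G (r + 1) U) =
      ∑ t ∈ cliquesIn G (r + 1) U, #t := by
    rw [mul_comm, ← smul_eq_mul, ← sum_const]
    exact sum_congr rfl fun t ht => (mem_cliquesIn.1 ht).1.2.symm
  rw [h, ← card_sigma, ← card_sigma]
  refine card_nbij' (fun x => ⟨x.2, x.1.erase x.2⟩) (fun x => ⟨insert x.1 x.2, x.1⟩) ?_ ?_ ?_ ?_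
  · rintro ⟨t, i⟩ h
    simp only [coe_sigma, Set.mem_sigma_iff, mem_coe, mem_cliquesIn] at h ⊢
    obtain ⟨⟨⟨htU, htc⟩, ht⟩, hi⟩ := h
    refine ⟨htU hi, ⟨fun j hj => ?_, by rw [card_erase_of_mem hi, htc]; rfl⟩, ?_⟩
    · rw [mem_erase] at hj
      exact mem_filter.2 ⟨htU hj.2, ht hi hj.2 hj.1.symm⟩
    · exact ht.subset (erase_subset _ _)
  · rintro ⟨i, t⟩ h
    simp only [coe_sigma, Set.mem_sigma_iff, mem_coe, mem_cliquesIn] at h ⊢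
    obtain ⟨hi, ⟨htU, htc⟩, ht⟩ := h
    have hit : i ∉ t := fun h => (mem_filter.1 (htU h)).2.ne rfl
    refine ⟨⟨⟨insert_subset hi fun j hj => (mem_filter.1 (htU hj)).1, ?_⟩, ?_⟩,
      mem_insert_self _ _⟩
    · rw [card_insert_of_notMem hit, htc]
    · rw [coe_insert, SimpleGraph.isClique_insert]
      exact ⟨ht, fun j hj _ => (mem_filter.1 (htU hj)).2⟩
  · rintro ⟨t, i⟩ h
    simp only [coe_sigma, Set.mem_sigma_iff, mem_coe] at h
    simp only [insert_erase h.2]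
  · rintro ⟨i, t⟩ h
    simp only [coe_sigma, Set.mem_sigma_iff, mem_coe, mem_cliquesIn] at h
    have hit : i ∉ t := fun h' => (mem_filter.1 (h.2.1.1 h')).2.ne rfl
    simp only [erase_insert hit]

lemma cliqueSum_indicator {V : Type*} [Fintype V] [DecidableEq V] (G : SimpleGraph V)
    [DecidableRel G.Adj] (r : ℕ) (U : Finset V) :
    cliqueSum (fun i j => if G.Adj i j then (1 : ℝ) else 0) r (fun i => if i ∈ U then 1 else 0) =
      r.factorial * (#(cliquesIn G r U) : ℝ) := by
  induction r generalizing U with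
  | zero =>
    simp [cliquesIn, filter_singleton, cliqueSum]
  | succ r ih =>
    have hlink : ∀ i, linkWeight (fun i j => if G.Adj i j then (1 : ℝ) else 0)
        (fun i => if i ∈ U then 1 else 0) i =
        fun j => if j ∈ ({j ∈ U | G.Adj i j} : Finset V) then 1 else 0 := fun i => by
      funext j
      simp only [linkWeight, mem_filter, ← ite_and, mul_ite, mul_one, mul_zero]
    have h := card_cliquesIn_succ G r U
    rw [cliqueSum_succ]
    simp only [hlink, ih, ite_mul, one_mul, zero_mul, sum_ite_mem, univ_inter]
    rw [← mul_sum, Nat.factorial_succ, mul_comm (r + 1), Nat.cast_mul, mul_assoc]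
    congr 1
    exact_mod_cast h.symm

lemma kcliques_eq {V : Type*} [Fintype V] [DecidableEq V] (G : SimpleGraph V)
    [DecidableRel G.Adj] (r : ℕ) :
    r.factorial * (kcliques G r : ℝ) =
      cliqueSum (fun i j => if G.Adj i j then (1 : ℝ) else 0) r (fun _ => 1) := by
  have h := cliqueSum_indicator G r univ
  simp only [mem_univ, if_true] at h
  rw [h, kcliques, ← Set.ncard_coe_finset]
  congr 2
  refine congrArg Set.ncard ?_
  ext t
  simp [mem_cliquesIn, SimpleGraph.isNClique_iff, and_comm]

lemma cliqueSum_two_eq {V : Type*} [Fintype V] [DecidableEq V] (G : SimpleGraph V)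
    [DecidableRel G.Adj] :
    cliqueSum (fun i j => if G.Adj i j then (1 : ℝ) else 0) 2 (fun _ => 1) =
      2 * (G.edgeSet.ncard : ℝ) := by
  have h := G.sum_degrees_eq_twice_card_edges
  rw [← SimpleGraph.coe_edgeFinset, Set.ncard_coe_finset]
  have h' : ∑ i, (G.degree i : ℝ) = 2 * (#G.edgeFinset : ℝ) := by exact_mod_cast h
  rw [← h', cliqueSum_add_two]
  refine sum_congr rfl fun i _ => ?_
  simp only [cliqueSum, one_mul, mul_one, sum_boole, ← SimpleGraph.card_neighborFinset_eq_degree,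
    SimpleGraph.neighborFinset_eq_filter]

lemma isEdgeWeight_adj {V : Type*} (G : SimpleGraph V) [DecidableRel G.Adj] :
    IsEdgeWeight fun i j => if G.Adj i j then (1 : ℝ) else 0 where
  symm i j := by simp only [G.adj_comm]
  nonneg i j := by positivity
  le_one i j := by split_ifs <;> norm_num

end CliqueCount

lemma cast_choose_four (p : ℕ) :
    24 * ((p + 1).choose 4 : ℝ) = (p + 1) * p * (p - 1) * (p - 2) := by
  rcases p with _ | _ | k
  · norm_num [Nat.choose_eq_zero_iff]
  · norm_num [Nat.choose_eq_zero_iff]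
  · have h : (k + 3).descFactorial 4 = Nat.factorial 4 * (k + 3).choose 4 :=
      Nat.descFactorial_eq_factorial_mul_choose _ _
    have h' : (k + 3).descFactorial 4 = k * ((k + 1) * ((k + 2) * (k + 3))) := by
      simp [Nat.descFactorial]
    have h2 : (24 * (k + 3).choose 4 : ℝ) = k * ((k + 1) * ((k + 2) * (k + 3))) := by
      exact_mod_cast h.symm.trans h'
    push_cast
    rw [show k + 1 + 1 + 1 = k + 3 from rfl, h2]
    ring

theorem four_cliques_lower_bound (n m : ℕ) (hn : 4 ≤ n) (hm1 : 1 ≤ m) (hm2 : m ≤ n.choose 2)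
    (G : SimpleGraph (Fin n)) (hG : G.edgeSet.ncard = m) :
    (kcliques G 4 : ℝ) ≥
      ((sOf n m).choose 4 : ℝ) * (1 / (sOf n m : ℝ) ^ 4) *
        ((n : ℝ) - 3 * Real.sqrt ((n : ℝ) ^ 2 - 2 * (sOf n m : ℝ) * (m : ℝ) / ((sOf n m : ℝ) - 1))) *
        ((n : ℝ) + Real.sqrt ((n : ℝ) ^ 2 - 2 * (sOf n m : ℝ) * (m : ℝ) / ((sOf n m : ℝ) - 1))) ^ 3 := by
  classical
  have hn0 : (0 : ℝ) < n := by exact_mod_cast (by omega : 0 < n)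
  have hm0 : (0 : ℝ) < m := by exact_mod_cast hm1
  have hmn : 2 * (m : ℝ) ≤ n * (n - 1) := by
    have h : (m : ℝ) ≤ n.choose 2 := by exact_mod_cast hm2
    rw [Nat.cast_choose_two] at h
    linarith
  set x : ℝ := 1 - 2 * (m : ℝ) / (n : ℝ) ^ 2 with hx
  have hxn : n ^ 2 * x = n ^ 2 - 2 * m := by rw [hx]; field_simp
  have hx0 : 0 < x := pos_of_mul_pos_right (by rw [hxn]; linarith) (sq_nonneg (n : ℝ))
  have hx1 : x < 1 := by
    rw [hx, sub_lt_self_iff]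
    positivity
  obtain ⟨p, hp⟩ : ∃ p, sOf n m = p + 1 := by
    refine Nat.exists_eq_succ_of_ne_zero (Nat.ceil_pos.2 ?_).ne'
    positivity
  have hlt : p < 1 / x := Nat.lt_ceil.1 (p.lt_succ_self.trans_eq hp.symm)
  have hle : 1 / x ≤ p + 1 := by
    have h := Nat.le_ceil (1 / x)
    rw [show ⌈1 / x⌉₊ = p + 1 from hp] at h
    push_cast at h
    exact h
  have hp1 : 1 ≤ p := by
    by_contra! h
    obtain rfl : p = 0 := by omega
    rw [div_le_iff₀ hx0] at hle
    norm_num at hle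
    linarith
  have hp1' : (1 : ℝ) ≤ p := by exact_mod_cast hp1
  have hp0 : (0 : ℝ) < p := by linarith
  have hpx : p * x < 1 := (lt_div_iff₀ hx0).1 hlt
  have hpx' : 1 ≤ (p + 1) * x := (div_le_iff₀ hx0).1 hle
  have hxp : p * (n ^ 2 * x) = p * (n ^ 2 - 2 * m) := by rw [hxn]
  rw [hp]
  push_cast
  rw [add_sub_cancel_right]
  set R := √((n : ℝ) ^ 2 - 2 * ((p : ℝ) + 1) * m / p) with hR
  have hR0 : 0 ≤ R := Real.sqrt_nonneg _
  have hR2 : p * R ^ 2 = p * n ^ 2 - 2 * (p + 1) * m := by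
    rw [hR, Real.sq_sqrt]
    · field_simp
    · rw [sub_nonneg, div_le_iff₀ hp0]
      have := mul_le_mul_of_nonneg_left hpx' (sq_nonneg (n : ℝ))
      linarith
  have hRn : p * R ≤ n := by
    refine abs_le_of_sq_le_sq' ?_ hn0.le |>.2
    have := mul_le_mul_of_nonneg_left hpx.le (show (0 : ℝ) ≤ n ^ 2 * (p + 1) by positivity)
    linear_combination this + p * hR2 - (p + 1) * hxp
  have key := cliqueDensityBound_four hp1 _ (fun _ => 1) ((n + R) / (p + 1)) ((n - p * R) / (p + 1))
    (isEdgeWeight_adj G) (fun _ => zero_le_one) (div_nonneg (by linarith) (by linarith))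
    (by gcongr; nlinarith) (by simp; field_simp; ring)
    (by
      rw [cliqueSum_two_eq, hG]
      field_simp
      linear_combination (p + 1 : ℝ) * hR2)
  rw [← kcliques_eq, show ((Nat.factorial 4 : ℕ) : ℝ) = 24 by norm_num [Nat.factorial]] at key
  refine le_of_mul_le_mul_left (key.trans' (le_of_eq ?_)) (show (0 : ℝ) < 24 by norm_num)
  have hc := cast_choose_four p
  rw [← mul_assoc, ← mul_assoc, ← mul_assoc, hc]
  push_cast
  field_simp
  ring
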